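/- arXiv:2407.02958 — 8 statements merged into one kernel-verified Lean document; each statement's English description precedes it below -/
import Mathlib

section
/- For a finite tree T, the following are equivalent: (1) T is strongly balanced; (2) T has a perfect matching M and there exists a leaf r of T such that for every vertex v, the unique path in T from r to v alternates between edges in M and edges not in M. -/
/-- A tree (more generally, a graph) `T` is *strongly balanced* if it admits a proper
2-coloring (i.e. a bipartition of the vertex set) such that on one side of the bipartition
exactly one vertex is a leaf (has degree `1`) and all the other vertices on that side have
degree `2`.  Degrees are expressed via `Set.ncard` of the neighbor set. -/
def StronglyBalanced {V : Type*} (T : SimpleGraph V) : Prop :=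
  ∃ c : V → Bool,
    (∀ u v : V, T.Adj u v → c u ≠ c v) ∧
    ∃ b : Bool, ∃ u : V, c u = b ∧ (T.neighborSet u).ncard = 1 ∧
      ∀ v : V, c v = b → v ≠ u → (T.neighborSet v).ncard = 2

namespace SimpleGraph

variable {V : Type*} {T : SimpleGraph V}

lemma IsTree.length_eq_dist (hT : T.IsTree) {u v : V} {p : T.Walk u v} (hp : p.IsPath) :
    p.length = T.dist u v := by
  obtain ⟨q, hq, hl⟩ := hT.connected.exists_path_of_dist u v
  rw [← hl, (hT.existsUnique_path u v).unique hp hq]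

/-- In a rooted tree, the parent of a vertex is unique. -/
lemma IsTree.eq_of_adj_of_dist_eq_add_one (hT : T.IsTree) {r v x y : V}
    (hx : T.Adj x v) (hy : T.Adj y v)
    (hdx : T.dist r v = T.dist r x + 1) (hdy : T.dist r v = T.dist r y + 1) : x = y := by
  obtain ⟨p, hp⟩ := hT.connected.exists_walk_length_eq_dist r x
  obtain ⟨q, hq⟩ := hT.connected.exists_walk_length_eq_dist r y
  have hp' : (p.concat hx).IsPath :=
    Walk.isPath_of_length_eq_dist _ (by rw [Walk.length_concat, hp, hdx])
  have hq' : (q.concat hy).IsPath :=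
    Walk.isPath_of_length_eq_dist _ (by rw [Walk.length_concat, hq, hdy])
  have h := congrArg Walk.penultimate ((hT.existsUnique_path r v).unique hp' hq')
  simpa using h

/-- In a rooted tree, every vertex other than the root has a parent. -/
lemma IsTree.exists_adj_dist_eq_add_one (hT : T.IsTree) {r v : V} (hv : v ≠ r) :
    ∃ w, T.Adj w v ∧ T.dist r v = T.dist r w + 1 := by
  obtain ⟨p, hp, hl⟩ := hT.connected.exists_path_of_dist r v
  have hnil : ¬ p.Nil := fun h => hv h.eq.symm
  have hadj := p.adj_penultimate hnil
  refine ⟨p.penultimate, hadj, ?_⟩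
  have hle : T.dist r p.penultimate ≤ p.dropLast.length := dist_le _
  have hlen : p.dropLast.length + 1 = p.length := by
    rw [← Walk.length_concat _ hadj, p.concat_dropLast hadj]
  rcases hT.dist_eq_dist_add_one_of_adj r hadj with h | h <;> omega

lemma IsTree.dist_getVert (hT : T.IsTree) {u v : V} {p : T.Walk u v} (hp : p.IsPath) {i : ℕ}
    (hi : i ≤ p.length) : T.dist u (p.getVert i) = i := by
  rw [← hT.length_eq_dist (hp.take i), Walk.take_length, min_eq_left hi]

/-- In a tree rooted at `r` whose edges lie in `M` exactly at even depth, every path from `r`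
alternates. -/
lemma IsTree.isChain_edges_of_even (hT : T.IsTree) {M : T.Subgraph} {r : V}
    (hM : ∀ x y, T.Adj x y → T.dist r y = T.dist r x + 1 → (M.Adj x y ↔ Even (T.dist r x)))
    {v : V} {p : T.Walk r v} (hp : p.IsPath) :
    p.edges.IsChain (fun e f => (e ∈ M.edgeSet ↔ f ∉ M.edgeSet)) := by
  have key : ∀ i (hi : i < p.edges.length), p.edges[i] ∈ M.edgeSet ↔ Even i := by
    intro i hi
    have hi' : i < p.length := by simpa using hi
    rw [Walk.getElem_edges hi, Subgraph.mem_edgeSet,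
      hM _ _ (p.adj_getVert_succ hi') (by
        rw [hT.dist_getVert hp hi'.le, hT.dist_getVert hp hi']), hT.dist_getVert hp hi'.le]
  rw [List.isChain_iff_getElem]
  intro i hi
  rw [key, key, Nat.even_add_one, not_not]

/-- If every path from the leaf `r` alternates, then the edges of the perfect matching are
exactly those at even depth. -/
lemma IsTree.adj_iff_even_of_isChain_edges (hT : T.IsTree) {M : T.Subgraph}
    (hPM : M.IsPerfectMatching) {r : V} (hr : (T.neighborSet r).ncard = 1)
    (hM : ∀ (v : V) (p : T.Walk r v), p.IsPath →
      p.edges.IsChain (fun e f => (e ∈ M.edgeSet ↔ f ∉ M.edgeSet)))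
    {x y : V} (hxy : T.Adj x y) (hd : T.dist r y = T.dist r x + 1) :
    M.Adj x y ↔ Even (T.dist r x) := by
  induction hn : T.dist r x generalizing x y with
  | zero =>
    obtain rfl := hT.connected.dist_eq_zero_iff.1 hn
    obtain ⟨a, ha⟩ := Set.ncard_eq_one.1 hr
    obtain ⟨z, hz, -⟩ := Subgraph.isPerfectMatching_iff.1 hPM r
    have hya : y = a := by simpa [ha] using (mem_neighborSet T r y).2 hxy
    have hza : z = a := by simpa [ha] using (mem_neighborSet T r z).2 hz.adj_sub
    simpa [hya, ← hza] using hz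
  | succ k ih =>
    have hxr : x ≠ r := by
      rintro rfl
      simp at hn
    obtain ⟨w, hwx, hw⟩ := hT.exists_adj_dist_eq_add_one hxr
    have hwk : T.dist r w = k := by omega
    obtain ⟨p, hp⟩ := hT.connected.exists_walk_length_eq_dist r w
    have hpath : ((p.concat hwx).concat hxy).IsPath :=
      Walk.isPath_of_length_eq_dist _ (by simp only [Walk.length_concat]; omega)
    have hchain := hM _ _ hpath
    have := ih hwx hw hwk
    simp only [Walk.edges_concat, List.concat_eq_append, List.append_assoc] at hchain
    have h2 := hchain.right_of_append
    simp only [List.cons_append, List.nil_append, List.isChain_cons_cons,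
      Subgraph.mem_edgeSet] at h2
    rw [Nat.even_add_one, ← this]
    tauto

/-- The edges of a tree rooted at `r` that join a vertex of even depth to one of its children. -/
def evenDepthSubgraph (T : SimpleGraph V) (r : V) : T.Subgraph where
  verts := Set.univ
  Adj x y := T.Adj x y ∧ (Even (T.dist r x) ∧ T.dist r y = T.dist r x + 1 ∨
    Even (T.dist r y) ∧ T.dist r x = T.dist r y + 1)
  adj_sub h := h.1
  edge_vert _ := Set.mem_univ _
  symm := ⟨fun _ _ h => ⟨h.1.symm, h.2.symm⟩⟩

lemma IsTree.isPerfectMatching_evenDepthSubgraph (hT : T.IsTree) {r : V}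
    (hr : (T.neighborSet r).ncard = 1)
    (h2 : ∀ v, Even (T.dist r v) → v ≠ r → (T.neighborSet v).ncard = 2) :
    (T.evenDepthSubgraph r).IsPerfectMatching := by
  have hchild : ∀ v, Even (T.dist r v) → ∃! w, T.Adj v w ∧ T.dist r w = T.dist r v + 1 := by
    intro v hv
    by_cases hvr : v = r
    · subst hvr
      obtain ⟨a, ha⟩ := Set.ncard_eq_one.1 hr
      have hmem : ∀ w, T.Adj v w ↔ w = a := fun w => by
        rw [← mem_neighborSet, ha, Set.mem_singleton_iff]
      have hva : T.Adj v a := (hmem a).2 rfl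
      exact ⟨a, ⟨hva, by simp [dist_eq_one_iff_adj.2 hva]⟩, fun w hw => (hmem w).1 hw.1⟩
    · obtain ⟨w, hwv, hw⟩ := hT.exists_adj_dist_eq_add_one hvr
      obtain ⟨a, b, hab, hs⟩ := Set.ncard_eq_two.1 (h2 v hv hvr)
      have hmem : ∀ w, T.Adj v w ↔ w = a ∨ w = b := fun w => by
        rw [← mem_neighborSet, hs]; rfl
      wlog hwa : w = a generalizing a b
      · exact this b a hab.symm (by rw [hs, Set.pair_comm]) (fun w => by rw [hmem, or_comm])
          (((hmem w).1 hwv.symm).resolve_left hwa)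
      subst hwa
      have hvb : T.Adj v b := (hmem b).2 (Or.inr rfl)
      refine ⟨b, ⟨hvb, ?_⟩, ?_⟩
      · rcases hT.dist_eq_dist_add_one_of_adj r hvb with h | h
        · exact (hab (hT.eq_of_adj_of_dist_eq_add_one hwv hvb.symm hw h)).elim
        · exact h
      · rintro z ⟨hz, hdz⟩
        rcases (hmem z).1 hz with rfl | rfl
        · omega
        · rfl
  rw [Subgraph.isPerfectMatching_iff]
  intro v
  by_cases hv : Even (T.dist r v)
  · obtain ⟨w, ⟨hvw, hd⟩, huniq⟩ := hchild v hv
    refine ⟨w, ⟨hvw, Or.inl ⟨hv, hd⟩⟩, ?_⟩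
    rintro z ⟨hz, ⟨-, h⟩ | ⟨he, h⟩⟩
    · exact huniq z ⟨hz, h⟩
    · rw [h, Nat.even_add_one] at hv
      exact (hv he).elim
  · have hvr : v ≠ r := by
      rintro rfl
      simp at hv
    obtain ⟨w, hwv, hw⟩ := hT.exists_adj_dist_eq_add_one hvr
    have hew : Even (T.dist r w) := by
      rwa [hw, Nat.even_add_one, not_not] at hv
    refine ⟨w, ⟨hwv.symm, Or.inr ⟨hew, hw⟩⟩, ?_⟩
    rintro z ⟨hz, ⟨he, -⟩ | ⟨-, h⟩⟩
    · exact (hv he).elim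
    · exact hT.eq_of_adj_of_dist_eq_add_one hz.symm hwv h hw

/-- A proper two-coloring of a tree is determined by the parity of the depth. -/
lemma IsTree.eq_color_iff_even_dist (hT : T.IsTree) {c : V → Bool}
    (hc : ∀ u v, T.Adj u v → c u ≠ c v) (r v : V) : c v = c r ↔ Even (T.dist r v) := by
  induction hn : T.dist r v generalizing v with
  | zero => simp [hT.connected.dist_eq_zero_iff.1 hn]
  | succ k ih =>
    have hvr : v ≠ r := by
      rintro rfl
      simp at hn
    obtain ⟨w, hwv, hw⟩ := hT.exists_adj_dist_eq_add_one hvr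
    have h := hc w v hwv
    rw [Nat.even_add_one, ← ih w (by omega)]
    revert h
    cases c v <;> cases c w <;> cases c r <;> simp

lemma IsTree.ncard_neighborSet_eq_two (hT : T.IsTree) {M : T.Subgraph}
    (hPM : M.IsPerfectMatching) {r : V}
    (hM : ∀ x y, T.Adj x y → T.dist r y = T.dist r x + 1 → (M.Adj x y ↔ Even (T.dist r x)))
    {v : V} (hv : Even (T.dist r v)) (hvr : v ≠ r) : (T.neighborSet v).ncard = 2 := by
  obtain ⟨w, hwv, hw⟩ := hT.exists_adj_dist_eq_add_one hvr
  obtain ⟨x, hvx, hx⟩ := Subgraph.isPerfectMatching_iff.1 hPM v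
  have hwx : w ≠ x := by
    rintro rfl
    have he := (hM w v hwv hw).1 hvx.symm
    rw [hw, Nat.even_add_one] at hv
    exact hv he
  rw [Set.ncard_eq_two]
  refine ⟨w, x, hwx, Set.ext fun z => ?_⟩
  simp only [mem_neighborSet, Set.mem_insert_iff, Set.mem_singleton_iff]
  refine ⟨fun hz => ?_, ?_⟩
  · rcases hT.dist_eq_dist_add_one_of_adj r hz with h | h
    · exact Or.inl (hT.eq_of_adj_of_dist_eq_add_one hz.symm hwv h hw)
    · exact Or.inr (hx z ((hM v z hz h).2 hv))
  · rintro (rfl | rfl)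
    exacts [hwv.symm, hvx.adj_sub]

end SimpleGraph

/-- Norose–Yamaguchi. For a finite tree `T`, the following are equivalent:
(1) `T` is strongly balanced; (2) `T` has a perfect matching `M` and there exists a leaf `r`
of `T` such that for every vertex `v`, the unique path in `T` from `r` to `v` alternates
between edges in `M` and edges not in `M`. -/
theorem stronglyBalanced_iff_alternating {V : Type*} [Fintype V]
    (T : SimpleGraph V) (hT : T.IsTree) :
    StronglyBalanced T ↔
      ∃ M : T.Subgraph, M.IsPerfectMatching ∧
        ∃ r : V, (T.neighborSet r).ncard = 1 ∧
          ∀ (v : V) (p : T.Walk r v), p.IsPath →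
            List.Chain' (fun e f => (e ∈ M.edgeSet ↔ f ∉ M.edgeSet)) p.edges := by
  constructor
  · rintro ⟨c, hc, b, r, rfl, hr, h2⟩
    refine ⟨T.evenDepthSubgraph r, hT.isPerfectMatching_evenDepthSubgraph hr
      (fun v hv => h2 v ((hT.eq_color_iff_even_dist hc r v).2 hv)), r, hr, fun v p hp => ?_⟩
    refine hT.isChain_edges_of_even (M := T.evenDepthSubgraph r)
      (fun x y hxy hd => ⟨?_, fun h => ⟨hxy, Or.inl ⟨h, hd⟩⟩⟩) hp
    rintro ⟨-, ⟨h, -⟩ | ⟨-, h⟩⟩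
    · exact h
    · omega
  · rintro ⟨M, hPM, r, hr, hM⟩
    have hMeven : ∀ x y, T.Adj x y → T.dist r y = T.dist r x + 1 →
        (M.Adj x y ↔ Even (T.dist r x)) :=
      fun _ _ => hT.adj_iff_even_of_isChain_edges hPM hr hM
    refine ⟨fun v => decide (Even (T.dist r v)), fun u v huv => ?_, true, r, by simp, hr,
      fun v hv => hT.ncard_neighborSet_eq_two hPM hMeven (of_decide_eq_true hv)⟩
    rcases hT.dist_eq_dist_add_one_of_adj r huv with h | h <;>
      simp [h, Nat.even_add_one, -Nat.not_even_iff_odd]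
end

section
/- If a finite tree T has a perfect matching M and there exists a leaf r of T such that for every vertex v the unique path in T from r to v alternates between edges in M and edges not in M, then T is strongly balanced. -/
/-- In a list along which membership in `S` alternates, starting with an element of `S`, the entries
in `S` are exactly those at even positions. -/
theorem List.IsChain.getElem_mem_iff_even {α : Type*} {S : Set α} {l : List α}
    (h : l.IsChain fun e f => (e ∈ S ↔ f ∉ S)) (h0 : ∀ h : 0 < l.length, l[0] ∈ S)
    (i : ℕ) (hi : i < l.length) : l[i] ∈ S ↔ Even i := by
  induction i with
  | zero => simp [h0]
  | succ i ih =>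
    have step := List.isChain_iff_getElem.1 h i hi
    rw [Nat.even_add_one, ← ih (by omega), step, not_not]

namespace SimpleGraph

variable {V : Type*} {T : SimpleGraph V}

/-- The edge of a perfect matching at a leaf `r` is the only edge at `r`. -/
theorem Subgraph.IsPerfectMatching.adj_of_ncard_neighborSet_eq_one {M : T.Subgraph}
    (hM : M.IsPerfectMatching) {r w : V} (hr : (T.neighborSet r).ncard = 1) (hw : T.Adj r w) :
    M.Adj r w := by
  obtain ⟨a, ha⟩ := Set.ncard_eq_one.1 hr
  obtain ⟨m, hm, -⟩ := Subgraph.isPerfectMatching_iff.1 hM r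
  have hwa : w ∈ T.neighborSet r := hw
  have hma : m ∈ T.neighborSet r := hm.adj_sub
  rw [ha] at hwa hma
  exact hwa.trans hma.symm ▸ hm

/-- Along a path in an alternating tree rooted at the leaf `r`, the edges of the matching are
exactly those at even positions. -/
theorem Walk.getElem_edges_mem_iff_even {M : T.Subgraph} (hM : M.IsPerfectMatching) {r v : V}
    (hr : (T.neighborSet r).ncard = 1) (p : T.Walk r v)
    (hp : p.edges.IsChain fun e f => (e ∈ M.edgeSet ↔ f ∉ M.edgeSet))
    (i : ℕ) (hi : i < p.edges.length) : p.edges[i] ∈ M.edgeSet ↔ Even i := by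
  refine hp.getElem_mem_iff_even (fun h => ?_) i hi
  cases p with
  | nil => simp at h
  | cons hadj q => simpa using hM.adj_of_ncard_neighborSet_eq_one hr hadj

/-- In an alternating tree rooted at the leaf `r`, every vertex other than `r` at the end of a path
of even length from `r` has degree two. -/
theorem IsTree.ncard_neighborSet_eq_two_of_even (hT : T.IsTree) {M : T.Subgraph}
    (hM : M.IsPerfectMatching) {r : V} (hr : (T.neighborSet r).ncard = 1)
    (halt : ∀ (v : V) (p : T.Walk r v), p.IsPath →
      p.edges.IsChain fun e f => (e ∈ M.edgeSet ↔ f ∉ M.edgeSet))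
    {v : V} (hv : v ≠ r) (p : T.Walk r v) (hp : p.IsPath) (heven : Even p.length) :
    (T.neighborSet v).ncard = 2 := by
  have hnil : ¬p.Nil := fun h => hv h.eq.symm
  have hpos : 0 < p.length := Nat.pos_of_ne_zero fun h => hnil (Walk.length_eq_zero_iff.1 h)
  obtain ⟨m, hm, hm_uniq⟩ := Subgraph.isPerfectMatching_iff.1 hM v
  have hparent : ¬M.Adj p.penultimate v := by
    have key := p.getElem_edges_mem_iff_even hM hr (halt v p hp) (p.length - 1) (by simp; omega)
    have hlast : s(p.penultimate, v) = p.edges[p.length - 1]'(by simp; omega) := by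
      rw [Walk.mk_penultimate_end_eq_getLast_edges hnil, List.getLast_eq_getElem]
      simp
    rw [← hlast, Subgraph.mem_edgeSet] at key
    rw [key]
    grind
  have hset : T.neighborSet v = {p.penultimate, m} := by
    ext w
    simp only [mem_neighborSet, Set.mem_insert_iff, Set.mem_singleton_iff]
    constructor
    · intro hw
      by_cases hmem : w ∈ p.support
      · exact .inl (hT.isAcyclic.eq_penultimate_of_adj_end hp hw hmem)
      · have key := (p.concat hw).getElem_edges_mem_iff_even hM hr
          (halt w _ (hp.concat hmem hw)) p.length (by simp)
        have hlast : (p.concat hw).edges[p.length]'(by simp) = s(v, w) := by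
          simp [Walk.edges_concat]
        rw [hlast, Subgraph.mem_edgeSet] at key
        exact .inr (hm_uniq w (key.2 heven))
    · rintro (rfl | rfl)
      · exact (p.adj_penultimate hnil).symm
      · exact hm.adj_sub
  rw [hset, Set.ncard_pair]
  intro h
  exact hparent (h ▸ hm.symm)

end SimpleGraph


/-- If a finite tree `T` has a perfect matching `M` and there exists a leaf
`r` of `T` such that for every vertex `v` the unique path in `T` from `r` to `v` alternates
between edges in `M` and edges not in `M`, then `T` is strongly balanced. -/
theorem alternating_imp_stronglyBalanced {V : Type*} [Fintype V]
    (T : SimpleGraph V) (hT : T.IsTree)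
    (M : T.Subgraph) (hM : M.IsPerfectMatching)
    (r : V) (hr : (T.neighborSet r).ncard = 1)
    (halt : ∀ (v : V) (p : T.Walk r v), p.IsPath →
      List.Chain' (fun e f => (e ∈ M.edgeSet ↔ f ∉ M.edgeSet)) p.edges) :
    StronglyBalanced T := by
  refine ⟨fun v => decide (Even (T.dist r v)), fun u v huv => ?_, true, r, by simp, hr,
    fun v hv hvr => ?_⟩
  · have := hT.dist_eq_dist_add_one_of_adj r huv
    grind
  · obtain ⟨p, hp, hlen⟩ := hT.connected.exists_path_of_dist r v
    exact hT.ncard_neighborSet_eq_two_of_even hM hr halt hvr p hp (by simpa [hlen] using hv)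
end

section
/- Every finite strongly balanced tree has a perfect matching. -/
namespace SimpleGraph

variable {V : Type*} {T : SimpleGraph V}

/-- In a rooted tree, every vertex other than the root has a unique neighbor closer to the root. -/
theorem IsTree.existsUnique_adj_dist_add_one (hT : T.IsTree) {r x : V} (hx : x ≠ r) :
    ∃! y, T.Adj x y ∧ T.dist r x = T.dist r y + 1 := by
  obtain ⟨p, hp, hpl⟩ := hT.connected.exists_path_of_dist r x
  have hnil : ¬ p.Nil := Walk.not_nil_of_ne hx.symm
  have hadj : T.Adj x p.penultimate := (p.adj_penultimate hnil).symm
  refine ⟨p.penultimate, ⟨hadj, ?_⟩, fun y hy ↦ ?_⟩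
  · have h₁ := dist_le p.dropLast
    have h₂ := p.length_dropLast_add_one hnil
    have h₃ := hT.dist_eq_dist_add_one_of_adj r hadj
    lia
  · obtain ⟨q, hq, hql⟩ := hT.connected.exists_path_of_dist r y
    have hqx : x ∉ q.support := fun hmem ↦ by
      classical
      have h₁ := dist_le (q.takeUntil x hmem)
      have h₂ := q.length_takeUntil_le_length hmem
      lia
    have hpq := (hT.existsUnique_path r x).unique hp (hq.concat hqx hy.1.symm)
    rw [hpq, Walk.penultimate_concat]

/-- In a rooted tree, a vertex of degree `2` other than the root has a unique child. -/
theorem IsTree.existsUnique_child_of_ncard_eq_two (hT : T.IsTree) {r x : V} (hx : x ≠ r)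
    (hdeg : (T.neighborSet x).ncard = 2) :
    ∃! y, T.Adj x y ∧ T.dist r y = T.dist r x + 1 := by
  obtain ⟨p, ⟨hxp, hp⟩, hpu⟩ := hT.existsUnique_adj_dist_add_one hx
  have hcard : (T.neighborSet x \ {p}).ncard = 1 := by
    rw [Set.ncard_sdiff_singleton_of_mem ((T.mem_neighborSet x p).2 hxp), hdeg]
  obtain ⟨y, hy⟩ := Set.ncard_eq_one.1 hcard
  have key (z : V) : T.Adj x z ∧ T.dist r z = T.dist r x + 1 ↔ z = y := by
    rw [← Set.mem_singleton_iff (b := y), ← hy, Set.mem_sdiff, mem_neighborSet, Set.mem_singleton_iff]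
    refine and_congr_right fun hxz ↦ ⟨?_, fun hzp ↦ ?_⟩
    · rintro hz rfl
      lia
    · rcases hT.dist_eq_dist_add_one_of_adj r hxz with h | h
      · exact absurd (hpu z ⟨hxz, h⟩) hzp
      · exact h
  exact ⟨y, (key y).2 rfl, fun z hz ↦ (key z).1 hz⟩

/-- A vertex of degree `1` has a unique neighbor, which is at distance `1` from it. -/
theorem existsUnique_child_of_ncard_eq_one {r : V} (hdeg : (T.neighborSet r).ncard = 1) :
    ∃! y, T.Adj r y ∧ T.dist r y = T.dist r r + 1 := by
  obtain ⟨y, hy⟩ := Set.ncard_eq_one.1 hdeg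
  have key (z : V) : T.Adj r z ↔ z = y := by
    rw [← mem_neighborSet, hy, Set.mem_singleton_iff]
  refine ⟨y, ⟨(key y).2 rfl, ?_⟩, fun z hz ↦ (key z).1 hz.1⟩
  rw [dist_self, zero_add, dist_eq_one_iff_adj, key]

end SimpleGraph

/-- Every finite strongly balanced tree has a perfect matching. -/
theorem stronglyBalanced_hasPerfectMatching {V : Type*} [Fintype V]
    (T : SimpleGraph V) (hT : T.IsTree) (hSB : StronglyBalanced T) :
    ∃ M : T.Subgraph, M.IsPerfectMatching := by
  obtain ⟨c, hc, b, r, hr, hr₁, h₂⟩ := hSB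
  let M : T.Subgraph :=
    { verts := Set.univ
      Adj := fun x y ↦ T.Adj x y ∧
        (c x = b ∧ T.dist r y = T.dist r x + 1 ∨ c y = b ∧ T.dist r x = T.dist r y + 1)
      adj_sub := And.left
      edge_vert := fun _ ↦ Set.mem_univ _
      symm := ⟨fun _ _ h ↦ ⟨h.1.symm, h.2.symm⟩⟩ }
  refine ⟨M, SimpleGraph.Subgraph.isPerfectMatching_iff.2 fun x ↦ ?_⟩
  by_cases hx : c x = b
  · have hM (y : V) : M.Adj x y ↔ T.Adj x y ∧ T.dist r y = T.dist r x + 1 :=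
      and_congr_right fun hxy ↦ by
        have := hc x y hxy
        grind
    simp only [hM]
    by_cases hxr : x = r
    · subst hxr
      exact SimpleGraph.existsUnique_child_of_ncard_eq_one hr₁
    · exact hT.existsUnique_child_of_ncard_eq_two hxr (h₂ x hx hxr)
  · have hM (y : V) : M.Adj x y ↔ T.Adj x y ∧ T.dist r x = T.dist r y + 1 :=
      and_congr_right fun hxy ↦ by
        have hy : c y = b := by
          rw [Bool.eq_not.2 (hc x y hxy).symm, Bool.eq_not.2 hx, Bool.not_not]
        simp [hx, hy]
    simp only [hM]
    exact hT.existsUnique_adj_dist_add_one (by grind)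
end

section
/- Let H be a finite simple graph on a vertex set V with |V| even, and suppose def(H) > 0 and (1/2)·def(H) < c_+(H). Then opt(H) = c(H) - 1; that is, the minimum cardinality of a set F of non-edges of H such that adding F to H yields a connected graph with a perfect matching equals c(H) - 1. -/
/-- The maximum cardinality of a matching in a simple graph `H`. -/
noncomputable def maxMatchingCard {V : Type*} (H : SimpleGraph V) : ℕ :=
  sSup {n : ℕ | ∃ M : H.Subgraph, M.IsMatching ∧ M.edgeSet.ncard = n}

/-- The deficiency of a finite simple graph `H`: the number of vertices minus twice the
maximum cardinality of a matching. -/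
noncomputable def deficiency {V : Type*} [Fintype V] (H : SimpleGraph V) : ℕ :=
  Fintype.card V - 2 * maxMatchingCard H

/-- The deficiency of a connected component `K` of `H`: the number of vertices of `K` minus
twice the maximum cardinality of a matching in (the subgraph of `H` induced on) `K`. -/
noncomputable def compDeficiency {V : Type*} (H : SimpleGraph V)
    (K : H.ConnectedComponent) : ℕ :=
  K.supp.ncard - 2 * maxMatchingCard (H.induce K.supp)

/-- `H` has a perfect matching. -/
def HasPerfectMatching {V : Type*} (H : SimpleGraph V) : Prop :=
  ∃ M : H.Subgraph, M.IsPerfectMatching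

/-- The set of cardinalities of sets `F` of non-edges of `H` (unordered pairs of distinct
vertices that are not edges of `H`) whose addition makes `H` connected and perfectly
matchable.  Its least element is `opt H`. -/
def optSet {V : Type*} (H : SimpleGraph V) : Set ℕ :=
  {n : ℕ | ∃ F : Finset (Sym2 V),
    (∀ e ∈ F, ¬ e.IsDiag) ∧ (∀ e ∈ F, e ∉ H.edgeSet) ∧
    (H ⊔ SimpleGraph.fromEdgeSet (↑F : Set (Sym2 V))).Connected ∧
    HasPerfectMatching (H ⊔ SimpleGraph.fromEdgeSet (↑F : Set (Sym2 V))) ∧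
    F.card = n}

/-- `c(H)`: the number of connected components of `H`. -/
noncomputable def numComponents {V : Type*} (H : SimpleGraph V) : ℕ :=
  Nat.card H.ConnectedComponent

/-- `c₊(H)`: the number of connected components of `H` with positive deficiency. -/
noncomputable def cPlus {V : Type*} (H : SimpleGraph V) : ℕ :=
  Nat.card {K : H.ConnectedComponent // 0 < compDeficiency H K}

/-- `c₀(H)`: the number of connected components of `H` with deficiency zero. -/
noncomputable def cZero {V : Type*} (H : SimpleGraph V) : ℕ :=
  Nat.card {K : H.ConnectedComponent // compDeficiency H K = 0}

/-- `F` is a set of pairs of elements of `V` that join distinct fibres of `f`, contract together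
with the fibres of `f` to a connected graph, and contain a perfect pairing of `S`. -/
structure IsPairingForest {V C : Type*} (f : V → C) (S : Finset V) (F : Finset (Sym2 V)) :
    Prop where
  ne : ∀ x y, s(x, y) ∈ F → f x ≠ f y
  pairs : ∃ m : V → V, ∀ x ∈ S, m x ∈ S ∧ m (m x) = x ∧ s(x, m x) ∈ F
  preconnected : ∀ G : SimpleGraph V, (∀ x y, f x = f y → G.Reachable x y) →
    (∀ x y, s(x, y) ∈ F → G.Reachable x y) → G.Preconnected

namespace IsPairingForest

variable {V C : Type*} [DecidableEq V] [DecidableEq C] {f : V → C} {S : Finset V}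
  {F : Finset (Sym2 V)} {u v : V}

lemma insert_edge (h : IsPairingForest (fun x => if f x = f v then f u else f x) S F)
    (huv : f u ≠ f v) : IsPairingForest f S (insert s(u, v) F) where
  ne x y hxy := by
    rcases Finset.mem_insert.1 hxy with hxy | hxy
    · rcases Sym2.eq_iff.1 hxy with ⟨rfl, rfl⟩ | ⟨rfl, rfl⟩
      exacts [huv, huv.symm]
    · intro hf
      exact h.ne x y hxy (by simp only [hf])
  pairs := by
    obtain ⟨m, hm⟩ := h.pairs
    exact ⟨m, fun x hx => ⟨(hm x hx).1, (hm x hx).2.1, Finset.mem_insert_of_mem (hm x hx).2.2⟩⟩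
  preconnected G hG hF := by
    have huv' : G.Reachable u v := hF u v (Finset.mem_insert_self _ _)
    refine h.preconnected G (fun x y hxy => ?_) fun x y hxy =>
      hF x y (Finset.mem_insert_of_mem hxy)
    by_cases hx : f x = f v <;> by_cases hy : f y = f v <;> 
      simp only [hx, hy, if_true, if_false] at hxy
    · exact hG x y (hx.trans hy.symm)
    · exact ((hG x v hx).trans huv'.symm).trans (hG u y hxy)
    · exact ((hG x u hxy).trans huv').trans (hG v y hy.symm)
    · exact hG x y hxy

lemma insert_pair (h : IsPairingForest (fun x => if f x = f v then f u else f x) S F)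
    (huv : f u ≠ f v) (hu : u ∉ S) (hv : v ∉ S) :
    IsPairingForest f (insert u (insert v S)) (insert s(u, v) F) where
  ne := (h.insert_edge huv).ne
  preconnected := (h.insert_edge huv).preconnected
  pairs := by
    obtain ⟨m, hm⟩ := h.pairs
    have hne : u ≠ v := fun e => huv (congrArg f e)
    refine ⟨fun x => if x = u then v else if x = v then u else m x, fun x hx => ?_⟩
    by_cases hxu : x = u
    · subst hxu
      simp [hne.symm]
    by_cases hxv : x = v
    · subst hxv
      simp [hxu, Sym2.eq_swap]
    have hxS : x ∈ S := by simpa [hxu, hxv] using hx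
    obtain ⟨h₁, h₂, h₃⟩ := hm x hxS
    have h₄ : m x ≠ u := fun e => hu (e ▸ h₁)
    have h₅ : m x ≠ v := fun e => hv (e ▸ h₁)
    simp [hxu, hxv, h₁, h₂, h₃, h₄, h₅]

end IsPairingForest

lemma card_image_merge {V C : Type*} [Fintype V] [DecidableEq C] (f : V → C) {u v : V}
    (huv : f u ≠ f v) :
    (Finset.univ.image fun x => if f x = f v then f u else f x).card + 1 =
      (Finset.univ.image f).card := by
  have : (Finset.univ.image fun x => if f x = f v then f u else f x) =
      (Finset.univ.image f).erase (f v) := by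
    ext a
    simp only [Finset.mem_image, Finset.mem_univ, true_and, Finset.mem_erase]
    constructor
    · rintro ⟨x, rfl⟩
      split_ifs with hx
      exacts [⟨huv, u, rfl⟩, ⟨hx, x, rfl⟩]
    · rintro ⟨ha, x, rfl⟩
      exact ⟨x, if_neg ha⟩
  rw [this, Finset.card_erase_add_one (Finset.mem_image_of_mem f (Finset.mem_univ v))]

/-- A nonempty set with fewer than two elements per fibre on average contains a pair in different
fibres such that, once the pair is removed and its fibres are merged, the remaining set is empty
or still has fewer than two elements per fibre. -/
lemma exists_pair_merge {V C : Type*} [DecidableEq V] [DecidableEq C] (f : V → C) {S : Finset V}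
    (heven : Even S.card) (hS : S.card < 2 * (S.image f).card) :
    ∃ u ∈ S, ∃ v ∈ S, f u ≠ f v ∧ ((S.erase u).erase v = ∅ ∨ ((S.erase u).erase v).card <
      2 * (((S.erase u).erase v).image fun x => if f x = f v then f u else f x).card) := by
  obtain ⟨v, hvS, hv⟩ : ∃ v ∈ S, ∀ w ∈ S, f w = f v → w = v := by
    by_contra! hcon
    refine hS.not_ge (Finset.mul_card_image_le_card (s := S) (f := f) 2 fun a ha => ?_)
    obtain ⟨v, hvS, rfl⟩ := Finset.mem_image.1 ha
    obtain ⟨w, hwS, hw, hne⟩ := hcon v hvS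
    exact Finset.one_lt_card.2 ⟨w, by simp [hwS, hw], v, by simp [hvS], hne⟩
  by_cases hex : ∃ u ∈ S, ∃ w ∈ S, w ≠ u ∧ f w = f u
  · obtain ⟨u, huS, w, hwS, hwu, hw⟩ := hex
    have huv : f u ≠ f v := fun e =>
      hwu ((hv w hwS (hw.trans e)).trans (hv u huS e).symm)
    have hne : u ≠ v := fun e => huv (congrArg f e)
    refine ⟨u, huS, v, hvS, huv, Or.inr ?_⟩
    have hsub : (S.image f).erase (f v) ⊆
        ((S.erase u).erase v).image fun x => if f x = f v then f u else f x := by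
      intro a ha
      obtain ⟨hav, ha⟩ := Finset.mem_erase.1 ha
      obtain ⟨x, hx, rfl⟩ := Finset.mem_image.1 ha
      by_cases hxu : x = u
      · subst hxu
        refine Finset.mem_image.2 ⟨w, ?_, by simp [hw, huv]⟩
        simp only [Finset.mem_erase, hwS, and_true]
        exact ⟨fun e => huv (by rw [← hw, e]), hwu⟩
      · refine Finset.mem_image.2 ⟨x, ?_, if_neg hav⟩
        simp only [Finset.mem_erase, hx, and_true]
        exact ⟨fun e => hav (congrArg f e), hxu⟩
    have h₁ := Finset.card_le_card hsub
    have h₂ := Finset.card_erase_add_one (Finset.mem_image_of_mem f hvS)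
    have h₃ := Finset.card_erase_add_one huS
    have h₄ := Finset.card_erase_add_one (Finset.mem_erase.2 ⟨hne.symm, hvS⟩)
    omega
  · push Not at hex
    obtain ⟨u, huS, huv⟩ : ∃ u ∈ S, u ≠ v := by
      refine Finset.exists_mem_ne ?_ v
      have := Finset.card_pos.2 ⟨v, hvS⟩
      obtain ⟨k, hk⟩ := heven
      omega
    refine ⟨u, huS, v, hvS, (hex u huS v hvS huv.symm).symm, ?_⟩
    refine (Finset.eq_empty_or_nonempty _).imp_right fun hne => ?_
    rw [Finset.card_image_of_injOn]
    · have := hne.card_pos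
      omega
    · intro x hx y hy hxy
      simp only [Finset.coe_erase, Set.mem_sdiff, Set.mem_singleton_iff, Finset.mem_coe] at hx hy
      have hxv : f x ≠ f v := (hex x hx.1.1 v hvS (Ne.symm hx.2)).symm
      have hyv : f y ≠ f v := (hex y hy.1.1 v hvS (Ne.symm hy.2)).symm
      simp only [hxv, hyv, if_false] at hxy
      by_contra hne'
      exact hex y hy.1.1 x hx.1.1 hne' hxy

theorem exists_isPairingForest {V C : Type*} [Fintype V] [Nonempty V] [DecidableEq V]
    [DecidableEq C] (f : V → C) (S : Finset V) (heven : Even S.card)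
    (hS : S = ∅ ∨ S.card < 2 * (S.image f).card) :
    ∃ F, IsPairingForest f S F ∧ F.card + 1 = (Finset.univ.image f).card := by
  induction hn : (Finset.univ.image f).card generalizing f S with
  | zero => simp [Finset.univ_eq_empty_iff] at hn
  | succ n ih =>
    have step : ∀ u v, f u ≠ f v → ∀ T : Finset V, Even T.card →
        (T = ∅ ∨ T.card < 2 * (T.image fun x => if f x = f v then f u else f x).card) →
        ∃ F, IsPairingForest (fun x => if f x = f v then f u else f x) T F ∧
          (insert s(u, v) F).card = n := by
      intro u v huv T hT hT'
      have hcard := card_image_merge f huv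
      obtain ⟨F, hF, hFn⟩ := ih _ T hT hT' (by omega)
      refine ⟨F, hF, ?_⟩
      rw [Finset.card_insert_of_notMem, hFn]
      exact fun hmem => hF.ne u v hmem (by simp [huv])
    rcases S.eq_empty_or_nonempty with rfl | hne
    · by_cases hconst : ∃ u v, f u ≠ f v
      · obtain ⟨u, v, huv⟩ := hconst
        obtain ⟨F, hF, hFn⟩ := step u v huv ∅ heven (Or.inl rfl)
        exact ⟨_, hF.insert_edge huv, by rw [hFn]⟩
      · push Not at hconst
        refine ⟨∅, ⟨by simp, ⟨id, by simp⟩, fun G hG _ x y => hG x y (hconst x y)⟩, ?_⟩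
        have : (Finset.univ.image f).card ≤ 1 := Finset.card_le_one.2 fun a ha b hb => by
          obtain ⟨x, -, rfl⟩ := Finset.mem_image.1 ha
          obtain ⟨y, -, rfl⟩ := Finset.mem_image.1 hb
          exact hconst x y
        simp
        omega
    · obtain ⟨u, hu, v, hv, huv, hT⟩ := exists_pair_merge f heven (hS.resolve_left hne.ne_empty)
      have hne' : v ≠ u := fun e => huv (congrArg f e.symm)
      have hv' : v ∈ S.erase u := Finset.mem_erase.2 ⟨hne', hv⟩
      have hTeven : Even ((S.erase u).erase v).card := by
        have h₁ := Finset.card_erase_add_one hu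
        have h₂ := Finset.card_erase_add_one hv'
        rw [Nat.even_iff] at heven ⊢
        omega
      obtain ⟨F, hF, hFn⟩ := step u v huv _ hTeven hT
      have := hF.insert_pair huv (by simp) (by simp)
      rw [Finset.insert_erase hv', Finset.insert_erase hu] at this
      exact ⟨_, this, by rw [hFn]⟩

lemma SimpleGraph.Subgraph.IsMatching.two_mul_ncard_edgeSet {V : Type*} [Finite V]
    {H : SimpleGraph V} {M : H.Subgraph} (hM : M.IsMatching) :
    2 * M.edgeSet.ncard = M.verts.ncard := by
  classical
  have := Fintype.ofFinite V
  have hsum := M.spanningCoe.sum_degrees_eq_twice_card_edges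
  have hdeg : ∀ v, M.spanningCoe.degree v = if v ∈ M.verts then 1 else 0 := by
    intro v
    rw [Subgraph.degree_spanningCoe]
    split_ifs with hv
    · exact isMatching_iff_forall_degree.1 hM v hv
    · exact Subgraph.degree_of_notMem_verts hv
  simp only [hdeg, Finset.sum_boole, Nat.cast_id] at hsum
  rw [← Subgraph.edgeSet_spanningCoe, ← coe_edgeFinset, Set.ncard_coe_finset, ← hsum,
    ← Set.ncard_coe_finset]
  simp

lemma bddAbove_matchingCards {V : Type*} [Finite V] (H : SimpleGraph V) :
    BddAbove {n : ℕ | ∃ M : H.Subgraph, M.IsMatching ∧ M.edgeSet.ncard = n} := by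
  refine ⟨Nat.card V, ?_⟩
  rintro n ⟨M, hM, rfl⟩
  have h₁ := hM.two_mul_ncard_edgeSet
  have h₂ := Set.ncard_le_card M.verts
  omega

lemma SimpleGraph.Subgraph.IsMatching.ncard_edgeSet_le {V : Type*} [Finite V]
    {H : SimpleGraph V} {M : H.Subgraph} (hM : M.IsMatching) :
    M.edgeSet.ncard ≤ maxMatchingCard H :=
  le_csSup (bddAbove_matchingCards H) ⟨M, hM, rfl⟩

lemma exists_isMatching_ncard_eq_maxMatchingCard {V : Type*} [Finite V] (H : SimpleGraph V) :
    ∃ M : H.Subgraph, M.IsMatching ∧ M.edgeSet.ncard = maxMatchingCard H :=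
  Nat.sSup_mem (s := {n : ℕ | ∃ M : H.Subgraph, M.IsMatching ∧ M.edgeSet.ncard = n})
    ⟨_, ⊥, by simp [SimpleGraph.Subgraph.IsMatching], rfl⟩ (bddAbove_matchingCards H)

/-- A matching of `H` leaves a vertex uncovered in each component of positive deficiency. -/
lemma exists_notMem_verts_of_compDeficiency_pos {V : Type*} [Finite V] {H : SimpleGraph V}
    {M : H.Subgraph} (hM : M.IsMatching) (K : H.ConnectedComponent)
    (hK : 0 < compDeficiency H K) : ∃ v ∉ M.verts, H.connectedComponentMk v = K := by
  by_contra! hcon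
  have hverts : ∀ v ∈ K.supp, v ∈ M.verts := fun v hv => by
    by_contra hvM
    exact hcon v hvM hv
  let N : (H.induce K.supp).Subgraph := M.comap (SimpleGraph.Embedding.induce K.supp).toHom
  have hadj : ∀ x y : K.supp, N.Adj x y ↔ M.Adj x y := by
    intro x y
    simp only [N, SimpleGraph.Subgraph.comap_adj]
    exact ⟨fun h => h.2, fun h => ⟨M.adj_sub h, h⟩⟩
  have hNv : N.verts = Set.univ := Set.eq_univ_of_forall fun x => hverts x x.2
  have hN : N.IsMatching := by
    intro x _
    obtain ⟨y, hy, hyu⟩ := hM (hverts x x.2)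
    refine ⟨⟨y, K.mem_supp_of_adj_mem_supp x.2 (M.adj_sub hy)⟩, (hadj _ _).2 hy, fun z hz => ?_⟩
    exact Subtype.ext (hyu z ((hadj _ _).1 hz))
  have h₁ := hN.two_mul_ncard_edgeSet
  have h₂ := hN.ncard_edgeSet_le
  rw [hNv, Set.ncard_univ, Nat.card_coe_set_eq] at h₁
  unfold compDeficiency at hK
  omega

lemma hasPerfectMatching_of_involutive {V : Type*} {G : SimpleGraph V} (m : V → V)
    (hadj : ∀ x, G.Adj x (m x)) (hinv : ∀ x, m (m x) = x) : HasPerfectMatching G := by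
  let M : G.Subgraph :=
    { verts := Set.univ
      Adj := fun x y => m x = y
      adj_sub := by rintro x y rfl; exact hadj x
      edge_vert := fun _ => Set.mem_univ _
      symm := ⟨by rintro x y rfl; exact hinv x⟩ }
  exact ⟨M, SimpleGraph.Subgraph.isPerfectMatching_iff.2 fun v =>
    ⟨m v, rfl, fun _ h => Eq.symm h⟩⟩

/-- A matching together with a pairing of the uncovered vertices along edges gives a perfect
matching. -/
lemma hasPerfectMatching_of_isMatching {V : Type*} {H G : SimpleGraph V} (hHG : H ≤ G)
    {M : H.Subgraph} (hM : M.IsMatching) (m : V → V)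
    (hm : ∀ x ∉ M.verts, m x ∉ M.verts ∧ m (m x) = x ∧ G.Adj x (m x)) :
    HasPerfectMatching G := by
  classical
  choose! p hp using fun x (hx : x ∈ M.verts) => (hM hx).exists
  refine hasPerfectMatching_of_involutive (fun x => if x ∈ M.verts then p x else m x)
    (fun x => ?_) fun x => ?_
  · by_cases hx : x ∈ M.verts
    · simpa only [hx, if_true] using hHG (M.adj_sub (hp x hx))
    · simpa only [hx, if_false] using (hm x hx).2.2
  · by_cases hx : x ∈ M.verts
    · have hpx : p x ∈ M.verts := M.edge_vert (hp x hx).symm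
      simp only [hx, hpx, if_true]
      exact hM.eq_of_adj_left (hp _ hpx) (hp x hx).symm
    · simp only [hx, (hm x hx).1, if_false, (hm x hx).2.1]

lemma numComponents_le_of_connected {V : Type*} [Finite V] (H : SimpleGraph V)
    (F : Finset (Sym2 V))
    (hF : (H ⊔ SimpleGraph.fromEdgeSet (F : Set (Sym2 V))).Connected) :
    numComponents H ≤ F.card + 1 := by
  classical
  have := hF.nonempty
  let E := F.image (Sym2.map H.connectedComponentMk)
  let T := SimpleGraph.fromEdgeSet (E : Set (Sym2 H.ConnectedComponent))
  have hreach : ∀ x y, T.Reachable (H.connectedComponentMk x) (H.connectedComponentMk y) := by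
    intro x y
    obtain ⟨w⟩ := hF.preconnected x y
    induction w with
    | nil => exact .refl _
    | @cons a b c hab _ ih =>
      refine SimpleGraph.Reachable.trans ?_ ih
      by_cases heq : H.connectedComponentMk a = H.connectedComponentMk b
      · rw [heq]
      rcases hab with hab | hab
      · exact absurd (SimpleGraph.ConnectedComponent.sound hab.reachable) heq
      · refine SimpleGraph.Adj.reachable ((SimpleGraph.fromEdgeSet_adj _).2 ⟨?_, heq⟩)
        exact Finset.mem_coe.2 (Finset.mem_image.2
          ⟨s(a, b), ((SimpleGraph.fromEdgeSet_adj _).1 hab).1, rfl⟩)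
  have hT : T.Connected :=
    { preconnected := SimpleGraph.ConnectedComponent.ind₂ hreach
      nonempty := this.map H.connectedComponentMk }
  have h₁ := hT.card_vert_le_card_edgeSet_add_one
  have h₂ : Nat.card T.edgeSet ≤ E.card := by
    rw [Nat.card_coe_set_eq, ← Set.ncard_coe_finset]
    refine Set.ncard_le_ncard ?_ E.finite_toSet
    rw [SimpleGraph.edgeSet_fromEdgeSet]
    exact Set.sdiff_subset
  have h₃ : E.card ≤ F.card := Finset.card_image_le
  unfold numComponents
  omega

/-- Lemma 2, Statement 2a. Let `H` be a finite simple graph on an even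
vertex set with `def(H) > 0` and `(1/2)·def(H) < c₊(H)` (equivalently `def(H) < 2·c₊(H)`).
Then `opt(H) = c(H) - 1`. -/
theorem augPMST_case_2a {V : Type*} [Fintype V] (H : SimpleGraph V)
    (heven : Even (Fintype.card V))
    (hdef : 0 < deficiency H) (hlt : deficiency H < 2 * cPlus H) :
    IsLeast (optSet H) (numComponents H - 1) := by
  constructor
  · classical
    have hV : Nonempty V := by
      rw [← Fintype.card_pos_iff]
      unfold deficiency at hdef
      omega
    obtain ⟨M, hM, hMcard⟩ := exists_isMatching_ncard_eq_maxMatchingCard H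
    let S : Finset V := Finset.univ.filter (· ∉ M.verts)
    have hScard : S.card = deficiency H := by
      have hverts := hM.two_mul_ncard_edgeSet
      have hsum := Set.ncard_add_ncard_compl M.verts
      have hS : S.card = (M.verts)ᶜ.ncard := by
        rw [← Set.ncard_coe_finset]
        congr 1
        ext x
        simp [S]
      rw [Nat.card_eq_fintype_card] at hsum
      unfold deficiency
      omega
    have hSeven : Even S.card := by
      rw [hScard, deficiency, Nat.even_iff]
      rw [Nat.even_iff] at heven
      omega
    have hcPlus : cPlus H ≤ (S.image H.connectedComponentMk).card := by
      rw [cPlus, ← Set.ncard_coe_finset]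
      refine Set.ncard_le_ncard (s := {K | 0 < compDeficiency H K}) (fun K hK => ?_)
        (Finset.finite_toSet _)
      obtain ⟨v, hv, rfl⟩ := exists_notMem_verts_of_compDeficiency_pos hM K hK
      exact Finset.mem_coe.2 (Finset.mem_image_of_mem _ (by simpa [S] using hv))
    obtain ⟨F, hF, hFcard⟩ := exists_isPairingForest H.connectedComponentMk S hSeven
      (Or.inr (by omega))
    have hadj : ∀ x y, s(x, y) ∈ F →
        (H ⊔ SimpleGraph.fromEdgeSet (F : Set (Sym2 V))).Adj x y := fun x y hxy =>
      Or.inr ((SimpleGraph.fromEdgeSet_adj _).2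
        ⟨hxy, fun e => hF.ne x y hxy (congrArg H.connectedComponentMk e)⟩)
    refine ⟨F, ?_, ?_, ?_, ?_, ?_⟩
    · intro e
      induction e with
      | h x y =>
        intro hxy hdiag
        exact hF.ne x y hxy (congrArg _ (Sym2.mk_isDiag_iff.1 hdiag))
    · intro e
      induction e with
      | h x y =>
        intro hxy hedge
        exact hF.ne x y hxy (SimpleGraph.ConnectedComponent.sound
          (SimpleGraph.Adj.reachable (H.mem_edgeSet.1 hedge)))
    · exact
        { preconnected := hF.preconnected _
            (fun x y hxy => (SimpleGraph.ConnectedComponent.exact hxy).mono le_sup_left)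
            fun x y hxy => (hadj x y hxy).reachable
          nonempty := hV }
    · obtain ⟨m, hm⟩ := hF.pairs
      refine hasPerfectMatching_of_isMatching le_sup_left hM m fun x hx => ?_
      obtain ⟨h₁, h₂, h₃⟩ := hm x (by simpa [S] using hx)
      exact ⟨by simpa [S] using h₁, h₂, hadj _ _ h₃⟩
    · have himage : Finset.univ.image H.connectedComponentMk = Finset.univ :=
        Finset.image_univ_of_surjective Quot.mk_surjective
      rw [himage, Finset.card_univ, ← Nat.card_eq_fintype_card] at hFcard
      unfold numComponents
      omega
  · rintro n ⟨F, -, -, hconn, -, rfl⟩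
    have := numComponents_le_of_connected H F hconn
    omega
end

section
/- Let H be a finite simple graph on a vertex set V with |V| even, and suppose def(H) > 0 and (1/2)·def(H) ≥ c_+(H). Then opt(H) = (1/2)·def(H) + c_0(H); that is, the minimum cardinality of a set F of non-edges of H such that adding F to H yields a connected graph with a perfect matching equals (1/2)·def(H) + c_0(H). -/
namespace SimpleGraph

variable {V : Type*} {G H : SimpleGraph V}

lemma Subgraph.IsMatching.two_mul_ncard_edgeSet_s9 [Finite V] {M : G.Subgraph} (hM : M.IsMatching) :
    2 * M.edgeSet.ncard = M.verts.ncard := by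
  classical
  have := Fintype.ofFinite V
  have h := M.spanningCoe.sum_degrees_eq_twice_card_edges
  have hdeg : ∀ v, M.spanningCoe.degree v = if v ∈ M.verts then 1 else 0 := by
    intro v
    rw [Subgraph.degree_spanningCoe]
    split_ifs with hv
    · exact Subgraph.isMatching_iff_forall_degree.1 hM v hv
    · exact Subgraph.degree_of_notMem_verts hv
  simp only [hdeg] at h
  rw [← Subgraph.edgeSet_spanningCoe, ← coe_edgeFinset, Set.ncard_coe_finset, ← h,
    Set.ncard_eq_toFinset_card']
  simp

lemma bddAbove_matching_ncard [Finite V] (G : SimpleGraph V) :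
    BddAbove {n : ℕ | ∃ M : G.Subgraph, M.IsMatching ∧ M.edgeSet.ncard = n} := by
  refine ⟨Nat.card V, ?_⟩
  rintro _ ⟨M, hM, rfl⟩
  have := hM.two_mul_ncard_edgeSet_s9
  have := Set.ncard_le_card M.verts
  omega

lemma Subgraph.IsMatching.ncard_verts_le [Finite V] {M : G.Subgraph} (hM : M.IsMatching) :
    M.verts.ncard ≤ 2 * maxMatchingCard G := by
  rw [← hM.two_mul_ncard_edgeSet_s9]
  exact Nat.mul_le_mul_left _ (le_csSup G.bddAbove_matching_ncard ⟨M, hM, rfl⟩)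

lemma exists_isMatching_ncard_verts_eq [Finite V] (G : SimpleGraph V) :
    ∃ M : G.Subgraph, M.IsMatching ∧ M.verts.ncard = 2 * maxMatchingCard G := by
  obtain ⟨M, hM, h⟩ := Nat.sSup_mem
    (s := {n : ℕ | ∃ M : G.Subgraph, M.IsMatching ∧ M.edgeSet.ncard = n})
    ⟨0, ⊥, by simp [Subgraph.IsMatching]⟩ G.bddAbove_matching_ncard
  exact ⟨M, hM, by rw [← hM.two_mul_ncard_edgeSet_s9, h, maxMatchingCard]⟩

lemma compDeficiency_eq_zero_iff [Finite V] (K : H.ConnectedComponent) :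
    compDeficiency H K = 0 ↔ ∃ M : H.Subgraph, M.IsMatching ∧ M.verts = K.supp := by
  constructor
  · intro h
    obtain ⟨M, hM, hcard⟩ := (H.induce K.supp).exists_isMatching_ncard_verts_eq
    refine ⟨M.map (Embedding.induce K.supp).toHom, hM.map _ Subtype.val_injective, ?_⟩
    have huniv : M.verts = Set.univ := by
      apply Set.eq_of_subset_of_ncard_le (Set.subset_univ _)
      rw [hcard, Set.ncard_univ, Nat.card_coe_set_eq]
      unfold compDeficiency at h
      omega
    ext v
    simp [huniv]
  · rintro ⟨M, hM, hv⟩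
    have hN : (M.comap (Embedding.induce K.supp).toHom).IsMatching := by
      rintro ⟨v, hvK⟩ -
      obtain ⟨w, hw, huniq⟩ := hM (hv ▸ hvK)
      have hwK : w ∈ K.supp := hv ▸ M.edge_vert hw.symm
      refine ⟨⟨w, hwK⟩, ⟨M.adj_sub hw, hw⟩, ?_⟩
      rintro ⟨y, hy⟩ ⟨-, hy'⟩
      exact Subtype.ext (huniq y hy')
    have h := hN.ncard_verts_le
    have huniv : (M.comap (Embedding.induce K.supp).toHom).verts = Set.univ := by
      ext ⟨v, hvK⟩
      simpa [hv] using hvK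
    rw [huniv, Set.ncard_univ, Nat.card_coe_set_eq] at h
    unfold compDeficiency
    omega

/-- Components of deficiency zero can be perfectly matched internally without exposing any vertex
covered by a given matching. -/
lemma Subgraph.IsMatching.exists_verts_eq_union [Finite V] {M : H.Subgraph} (hM : M.IsMatching) :
    ∃ M' : H.Subgraph, M'.IsMatching ∧
      M'.verts = M.verts ∪ {v | compDeficiency H (H.connectedComponentMk v) = 0} := by
  classical
  have key : ∀ K : H.ConnectedComponent, ∃ N : H.Subgraph, N.IsMatching ∧
      N.verts = (M.verts ∪ {v | compDeficiency H (H.connectedComponentMk v) = 0}) ∩ K.supp := by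
    intro K
    by_cases hK : compDeficiency H K = 0
    · obtain ⟨N, hN, hv⟩ := (compDeficiency_eq_zero_iff K).1 hK
      refine ⟨N, hN, ?_⟩
      ext v
      rw [hv]
      constructor
      · intro h
        exact ⟨Or.inr (by rw [ConnectedComponent.mem_supp_iff] at h; simpa [h] using hK), h⟩
      · exact fun h => h.2
    · refine ⟨M.induce (M.verts ∩ K.supp), hM.induce_connectedComponent K, ?_⟩
      ext v
      constructor
      · exact fun h => ⟨Or.inl h.1, h.2⟩
      · rintro ⟨h | h, hv⟩
        · exact ⟨h, hv⟩
        · rw [ConnectedComponent.mem_supp_iff] at hv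
          exact absurd (hv ▸ h) hK
  choose N hN hv using key
  refine ⟨⨆ K, N K, Subgraph.IsMatching.iSup hN ?_, ?_⟩
  · intro K L hKL
    rw [(hN K).support_eq_verts, (hN L).support_eq_verts, hv, hv, Set.disjoint_left]
    rintro v ⟨-, h1⟩ ⟨-, h2⟩
    exact hKL (h1.symm.trans h2)
  · rw [Subgraph.verts_iSup]
    ext v
    simp only [hv, Set.mem_iUnion, Set.mem_inter_iff, ConnectedComponent.mem_supp_iff]
    simp

lemma Subgraph.IsMatching.compDeficiency_eq_zero_of_subset [Finite V] {M : H.Subgraph}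
    (hM : M.IsMatching) {K : H.ConnectedComponent} (hK : K.supp ⊆ M.verts) :
    compDeficiency H K = 0 :=
  (compDeficiency_eq_zero_iff K).2
    ⟨_, hM.induce_connectedComponent K, Set.inter_eq_right.2 hK⟩

/-- A maximum matching covers every component of deficiency zero. -/
lemma Subgraph.IsMatching.mem_verts_of_compDeficiency_eq_zero [Finite V] {M : H.Subgraph}
    (hM : M.IsMatching) (hmax : M.verts.ncard = 2 * maxMatchingCard H) {v : V}
    (hv : compDeficiency H (H.connectedComponentMk v) = 0) : v ∈ M.verts := by
  obtain ⟨M', hM', hverts⟩ := hM.exists_verts_eq_union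
  have h := Set.eq_of_subset_of_ncard_le (s := M.verts) (t := M'.verts)
    (hverts ▸ Set.subset_union_left) (hmax ▸ hM'.ncard_verts_le)
  rw [h, hverts]
  exact Or.inr hv

/-- The vertices exposed by a maximum matching form an independent set. -/
lemma Subgraph.IsMatching.not_adj_of_notMem_verts [Finite V] {M : H.Subgraph}
    (hM : M.IsMatching) (hmax : M.verts.ncard = 2 * maxMatchingCard H) {u v : V}
    (hu : u ∉ M.verts) (hv : v ∉ M.verts) : ¬ H.Adj u v := by
  intro h
  have hsup : (M ⊔ H.subgraphOfAdj h).IsMatching := by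
    refine hM.sup (.subgraphOfAdj h) ?_
    rw [hM.support_eq_verts, (Subgraph.IsMatching.subgraphOfAdj h).support_eq_verts,
      Set.disjoint_right]
    rintro x (rfl | rfl) <;> assumption
  have hle := hsup.ncard_verts_le
  have hlt : M.verts.ncard < (M ⊔ H.subgraphOfAdj h).verts.ncard := by
    refine Set.ncard_lt_ncard ⟨Set.subset_union_left, fun hs => hu (hs (Or.inr ?_))⟩
    simp
  omega

lemma Subgraph.IsMatching.even_ncard_supp_diff [Finite V] {M : H.Subgraph} (hM : M.IsMatching)
    {K : H.ConnectedComponent} (hK : compDeficiency H K = 0) :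
    Even (K.supp \ M.verts).ncard := by
  obtain ⟨N, hN, hv⟩ := (compDeficiency_eq_zero_iff K).1 hK
  have h1 := hN.two_mul_ncard_edgeSet_s9
  have h2 := (hM.induce_connectedComponent K).two_mul_ncard_edgeSet_s9
  have h3 := Set.ncard_inter_add_ncard_sdiff_eq_ncard K.supp M.verts
  rw [hv] at h1
  rw [Subgraph.induce_verts, Set.inter_comm] at h2
  rw [Nat.even_iff]
  omega

/-- Contracting the fibres of `f`, each of which is a union of components of `H`, leaves a connected
graph whose edges come from the added edges joining different fibres. -/
lemma card_le_card_filter_not_isDiag_map_add_one {W : Type*} [Finite W] {f : V → W}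
    (hf : Function.Surjective f) (F : Finset (Sym2 V))
    (hconn : (H ⊔ fromEdgeSet (F : Set (Sym2 V))).Connected)
    (hH : ∀ a b, H.Adj a b → f a = f b) [DecidablePred fun e : Sym2 V => ¬ (e.map f).IsDiag] :
    Nat.card W ≤ (F.filter fun e => ¬ (e.map f).IsDiag).card + 1 := by
  classical
  set E := (F.filter fun e => ¬ (e.map f).IsDiag).image (Sym2.map f) with hE
  have hreach : ∀ a b, (H ⊔ fromEdgeSet (F : Set (Sym2 V))).Adj a b →
      (fromEdgeSet (E : Set (Sym2 W))).Reachable (f a) (f b) := by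
    intro a b hab
    by_cases hne : f a = f b
    · rw [hne]
    · rcases hab with hab | hab
      · exact absurd (hH a b hab) hne
      · refine Adj.reachable ?_
        rw [fromEdgeSet_adj] at hab ⊢
        refine ⟨?_, hne⟩
        rw [hE, Finset.mem_coe, Finset.mem_image]
        exact ⟨s(a, b), Finset.mem_filter.2 ⟨hab.1, by simpa using hne⟩, rfl⟩
  have hcon : (fromEdgeSet (E : Set (Sym2 W))).Connected := by
    have := hconn.nonempty.map f
    refine ⟨fun x y => ?_⟩
    obtain ⟨a, rfl⟩ := hf x
    obtain ⟨b, rfl⟩ := hf y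
    have h := hconn.preconnected a b
    rw [reachable_iff_reflTransGen] at h
    induction h with
    | refl => exact Reachable.refl _
    | tail _ hbc ih => exact ih.trans (hreach _ _ hbc)
  refine hcon.card_vert_le_card_edgeSet_add_one.trans (Nat.add_le_add_right ?_ 1)
  rw [Nat.card_coe_set_eq]
  calc (fromEdgeSet (E : Set (Sym2 W))).edgeSet.ncard ≤ (E : Set (Sym2 W)).ncard := by
        refine Set.ncard_le_ncard ?_
        rw [edgeSet_fromEdgeSet]
        exact Set.sdiff_subset
    _ = E.card := Set.ncard_coe_finset E
    _ ≤ _ := Finset.card_image_le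

/-- A perfect matching of a supergraph splits into a matching of `H` and a matching, by edges
outside `H`, of the vertices that the former leaves exposed. -/
lemma Subgraph.IsPerfectMatching.exists_isMatching_compl {M : G.Subgraph}
    (hM : M.IsPerfectMatching) (H : SimpleGraph V) :
    ∃ (A : H.Subgraph) (B : G.Subgraph), A.IsMatching ∧ B.IsMatching ∧ B.verts = A.vertsᶜ ∧
      ∀ a b, B.Adj a b → ¬ H.Adj a b := by
  rw [isPerfectMatching_iff] at hM
  refine ⟨⟨{v | ∃ w, M.Adj v w ∧ H.Adj v w}, fun a b => M.Adj a b ∧ H.Adj a b, fun h => h.2,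
      fun h => ⟨_, h⟩, ⟨fun a b h => ⟨h.1.symm, h.2.symm⟩⟩⟩,
    ⟨{v | ∃ w, M.Adj v w ∧ ¬ H.Adj v w}, fun a b => M.Adj a b ∧ ¬ H.Adj a b,
      fun h => M.adj_sub h.1, fun h => ⟨_, h⟩, ⟨fun a b h => ⟨h.1.symm, fun h' => h.2 h'.symm⟩⟩⟩,
    ?_, ?_, ?_, fun a b h => h.2⟩
  · rintro v ⟨w, hw⟩
    exact ⟨w, hw, fun y hy => (hM v).unique hy.1 hw.1⟩
  · rintro v ⟨w, hw⟩
    exact ⟨w, hw, fun y hy => (hM v).unique hy.1 hw.1⟩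
  · ext v
    obtain ⟨w, hw, -⟩ := hM v
    constructor
    · rintro ⟨x, hx, hx'⟩ ⟨y, hy, hy'⟩
      exact hx' ((hM v).unique hy hx ▸ hy')
    · exact fun h => ⟨w, hw, fun h' => h ⟨w, hw, h'⟩⟩

lemma Subgraph.IsMatching.deficiency_add_le_ncard_compl [Fintype V] {M : H.Subgraph}
    (hM : M.IsMatching) :
    deficiency H + 2 * Nat.card {K : H.ConnectedComponent //
      compDeficiency H K = 0 ∧ ¬ K.supp ⊆ M.verts} ≤ M.vertsᶜ.ncard := by
  classical
  obtain ⟨M', hM', hv⟩ := hM.exists_verts_eq_union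
  have h1 := hM'.ncard_verts_le
  have h2 := Set.ncard_add_ncard_compl M'.verts
  have h3 : (Finset.univ.filter fun K : H.ConnectedComponent =>
      compDeficiency H K = 0 ∧ ¬ K.supp ⊆ M.verts).card * 2 ≤ (M'.verts \ M.verts).ncard := by
    set Z := Finset.univ.filter fun K : H.ConnectedComponent =>
      compDeficiency H K = 0 ∧ ¬ K.supp ⊆ M.verts
    calc Z.card * 2 ≤ ∑ K ∈ Z, (K.supp \ M.verts).toFinset.card := by
          rw [← smul_eq_mul]
          refine Finset.card_nsmul_le_sum _ _ _ fun K hK => ?_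
          simp only [Z, Finset.mem_filter, Finset.mem_univ, true_and] at hK
          have he := hM.even_ncard_supp_diff hK.1
          have hpos : 0 < (K.supp \ M.verts).ncard :=
            (Set.ncard_pos).2 (Set.sdiff_nonempty.2 hK.2)
          rw [← Set.ncard_eq_toFinset_card']
          obtain ⟨k, hk⟩ := he
          omega
      _ = (Z.biUnion fun K => (K.supp \ M.verts).toFinset).card := by
          refine (Finset.card_biUnion fun K _ L _ hKL => ?_).symm
          rw [Function.onFun, Finset.disjoint_left]
          intro v hK hL
          simp only [Set.mem_toFinset, Set.mem_sdiff, ConnectedComponent.mem_supp_iff] at hK hL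
          exact hKL (hK.1.symm.trans hL.1)
      _ = ((Z.biUnion fun K => (K.supp \ M.verts).toFinset : Finset V) : Set V).ncard :=
          (Set.ncard_coe_finset _).symm
      _ ≤ _ := by
          refine Set.ncard_le_ncard ?_
          intro v hmem
          simp only [Z, Finset.mem_coe, Finset.mem_biUnion, Finset.mem_filter, Finset.mem_univ,
            true_and, Set.mem_toFinset, Set.mem_sdiff, ConnectedComponent.mem_supp_iff] at hmem
          obtain ⟨K, ⟨hK, -⟩, rfl, hvM⟩ := hmem
          exact ⟨hv ▸ Or.inr hK, hvM⟩
  have h4 : (M'.vertsᶜ ∪ (M'.verts \ M.verts)).ncard ≤ M.vertsᶜ.ncard := by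
    refine Set.ncard_le_ncard ?_
    rintro v (h | h)
    · exact fun h' => h (hv ▸ Or.inl h')
    · exact h.2
  rw [Set.ncard_union_eq (disjoint_compl_left.mono_right Set.sdiff_subset)] at h4
  rw [Nat.card_eq_fintype_card, Fintype.card_subtype]
  rw [Nat.card_eq_fintype_card] at h2
  unfold deficiency
  omega

lemma deficiency_div_two_add_cZero_le [Fintype V] (hdef : 0 < deficiency H) (F : Finset (Sym2 V))
    (hconn : (H ⊔ fromEdgeSet (F : Set (Sym2 V))).Connected)
    (hpm : HasPerfectMatching (H ⊔ fromEdgeSet (F : Set (Sym2 V)))) :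
    deficiency H / 2 + cZero H ≤ F.card := by
  classical
  obtain ⟨M, hM⟩ := hpm
  obtain ⟨A, B, hA, hB, hBv, hBH⟩ := hM.exists_isMatching_compl H
  have hcount := hA.deficiency_add_le_ncard_compl
  rw [← hBv, ← hB.two_mul_ncard_edgeSet_s9] at hcount
  let p : H.ConnectedComponent → Prop := fun K => compDeficiency H K = 0 ∧ K.supp ⊆ A.verts
  let f : V → Option {K // p K} := fun v =>
    if h : p (H.connectedComponentMk v) then some ⟨_, h⟩ else none
  have hfnone : ∀ v, v ∉ A.verts → f v = none := fun v hv => dif_neg fun h => hv (h.2 rfl)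
  have hf : Function.Surjective f := by
    rintro (_ | ⟨K, hK⟩)
    · have hpos : 0 < B.verts.ncard := by
        rw [← hB.two_mul_ncard_edgeSet_s9]
        omega
      obtain ⟨v, hv⟩ := Set.nonempty_of_ncard_ne_zero hpos.ne'
      exact ⟨v, hfnone v (by rwa [hBv] at hv)⟩
    · obtain ⟨v, rfl⟩ := K.exists_rep
      exact ⟨v, dif_pos hK⟩
  have hH : ∀ a b, H.Adj a b → f a = f b := by
    intro a b hab
    have : H.connectedComponentMk a = H.connectedComponentMk b :=
      ConnectedComponent.sound hab.reachable
    simp only [f, this]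
  have hcontract := card_le_card_filter_not_isDiag_map_add_one hf F hconn hH
  rw [Finite.card_option] at hcontract
  have hBF : B.edgeSet.ncard ≤ (F.filter fun e => (e.map f).IsDiag).card := by
    rw [← Set.ncard_coe_finset]
    refine Set.ncard_le_ncard ?_
    intro e
    induction e using Sym2.ind with
    | _ a b =>
      intro h
      have hab : B.Adj a b := h
      have ha : a ∉ A.verts := by
        have := B.edge_vert hab
        rwa [hBv] at this
      have hb : b ∉ A.verts := by
        have := B.edge_vert hab.symm
        rwa [hBv] at this
      rcases B.adj_sub hab with h' | h'
      · exact absurd h' (hBH a b hab)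
      · rw [fromEdgeSet_adj] at h'
        simpa [hfnone a ha, hfnone b hb] using h'.1
  have hsplit := Finset.card_filter_add_card_filter_not (s := F) fun e => (e.map f).IsDiag
  have hzero : cZero H = Nat.card {K // p K} + Nat.card {K : H.ConnectedComponent //
      compDeficiency H K = 0 ∧ ¬ K.supp ⊆ A.verts} := by
    simp only [cZero, p, Nat.card_eq_fintype_card, Fintype.card_subtype]
    rw [← Finset.filter_filter, ← Finset.filter_filter, Finset.card_filter_add_card_filter_not]
  omega

open Classical in
/-- Among at least two vertices meeting few components of `G` there is a pair whose removal, after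
joining it by an edge, preserves the bound on the number of components met. -/
lemma exists_pair_card_image_connectedComponentMk_le (G : SimpleGraph V) (n : ℕ) (U : Finset V)
    (hU : U.card = 2 * (n + 1)) (hk : 2 * (U.image G.connectedComponentMk).card ≤ U.card + 2) :
    ∃ u ∈ U, ∃ v ∈ U, u ≠ v ∧
      2 * ((U \ {u, v}).image
        (G ⊔ fromEdgeSet {s(u, v)}).connectedComponentMk).card ≤ 2 * n + 2 ∧
      (U ⊆ {u, v} ∨ ∃ w ∈ U \ {u, v}, G.Reachable u w) := by
  rcases Nat.eq_zero_or_pos n with rfl | hn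
  · obtain ⟨u, v, huv, rfl⟩ := Finset.card_eq_two.1 hU
    exact ⟨u, by simp, v, by simp, huv, by simp, Or.inl subset_rfl⟩
  have hmk : ∀ {u v a b : V}, G.connectedComponentMk a = G.connectedComponentMk b →
      (G ⊔ fromEdgeSet {s(u, v)}).connectedComponentMk a =
        (G ⊔ fromEdgeSet {s(u, v)}).connectedComponentMk b := fun h =>
    ConnectedComponent.sound ((ConnectedComponent.exact h).mono le_sup_left)
  obtain ⟨u, hu, w, hw, huw, hne⟩ : ∃ u ∈ U, ∃ w ∈ U,
      G.connectedComponentMk u = G.connectedComponentMk w ∧ u ≠ w := by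
    by_contra! h
    have : (U.image G.connectedComponentMk).card = U.card :=
      Finset.card_image_of_injOn fun a ha b hb hab => h a ha b hb hab
    omega
  by_cases hall : ∃ v ∈ U, G.connectedComponentMk v ≠ G.connectedComponentMk u
  · obtain ⟨v, hv, hvu⟩ := hall
    have huv : u ≠ v := fun h => hvu (h ▸ rfl)
    have hwv : w ≠ v := fun h => hvu (h ▸ huw.symm)
    refine ⟨u, hu, v, hv, huv, ?_, Or.inr ⟨w, by simp [hw, hne.symm, hwv],
      ConnectedComponent.exact huw⟩⟩
    have hsub : (U \ {u, v}).image (G ⊔ fromEdgeSet {s(u, v)}).connectedComponentMk ⊆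
        ((U.image G.connectedComponentMk).erase (G.connectedComponentMk v)).image
          (ConnectedComponent.map (Hom.ofLE le_sup_left)) := by
      intro C hC
      obtain ⟨x, hx, rfl⟩ := Finset.mem_image.1 hC
      have hxU := (Finset.mem_sdiff.1 hx).1
      rw [Finset.mem_image]
      by_cases hxv : G.connectedComponentMk x = G.connectedComponentMk v
      · refine ⟨G.connectedComponentMk u,
          Finset.mem_erase.2 ⟨hvu.symm, Finset.mem_image_of_mem _ hu⟩, ?_⟩
        rw [ConnectedComponent.map_mk, hmk hxv]
        refine ConnectedComponent.sound (Adj.reachable (Or.inr ?_))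
        simpa using huv
      · exact ⟨G.connectedComponentMk x,
          Finset.mem_erase.2 ⟨hxv, Finset.mem_image_of_mem _ hxU⟩, rfl⟩
    have h1 := (Finset.card_le_card hsub).trans Finset.card_image_le
    rw [Finset.card_erase_of_mem (Finset.mem_image_of_mem _ hv)] at h1
    omega
  · push Not at hall
    obtain ⟨v, hv⟩ : (U \ {u, w}).Nonempty := by
      rw [← Finset.card_pos]
      have := Finset.le_card_sdiff {u, w} U
      have := Finset.card_le_two (a := u) (b := w)
      omega
    simp only [Finset.mem_sdiff, Finset.mem_insert, Finset.mem_singleton, not_or] at hv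
    refine ⟨u, hu, v, hv.1, Ne.symm hv.2.1, ?_, Or.inr ⟨w, ?_, ConnectedComponent.exact huw⟩⟩
    · have hsub : (U \ {u, v}).image (G ⊔ fromEdgeSet {s(u, v)}).connectedComponentMk ⊆
          {(G ⊔ fromEdgeSet {s(u, v)}).connectedComponentMk u} := by
        intro C hC
        obtain ⟨x, hx, rfl⟩ := Finset.mem_image.1 hC
        exact Finset.mem_singleton.2 (hmk (hall x (Finset.mem_sdiff.1 hx).1))
      have := Finset.card_le_card hsub
      rw [Finset.card_singleton] at this
      omega
    · simp [hw, hne.symm, Ne.symm hv.2.2]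

open Classical in
/-- An even set of vertices meeting few components of `G` can be paired up so that adding the pairs
as edges puts all of its vertices into one component. -/
lemma exists_pairing_reachable (n : ℕ) (G : SimpleGraph V) (U : Finset V)
    (hU : U.card = 2 * n) (hk : 2 * (U.image G.connectedComponentMk).card ≤ U.card + 2) :
    ∃ P : Finset (Sym2 V), P.card = n ∧ (∀ e ∈ P, ¬ e.IsDiag) ∧ (∀ e ∈ P, ∀ x ∈ e, x ∈ U) ∧
      (∀ x ∈ U, ∃! y, s(x, y) ∈ P) ∧
      ∀ x ∈ U, ∀ y ∈ U, (G ⊔ fromEdgeSet (P : Set (Sym2 V))).Reachable x y := by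
  induction n generalizing G U with
  | zero =>
    obtain rfl : U = ∅ := Finset.card_eq_zero.1 (by simpa using hU)
    exact ⟨∅, by simp⟩
  | succ n ih =>
    obtain ⟨u, hu, v, hv, huv, hk', hw⟩ :=
      G.exists_pair_card_image_connectedComponentMk_le n U hU hk
    have hcard : (U \ {u, v}).card = 2 * n := by
      rw [Finset.card_sdiff_of_subset (by simp [Finset.insert_subset_iff, hu, hv]),
        Finset.card_pair huv]
      omega
    obtain ⟨P, hPc, hPd, hPU, hPm, hPr⟩ := ih _ _ hcard (hcard ▸ hk')
    have hmem : ∀ {x y}, s(x, y) ∈ P → x ∈ U ∧ x ≠ u ∧ x ≠ v := by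
      intro x y h
      simpa using hPU _ h x (by simp)
    have huP : s(u, v) ∉ P := fun h => (hmem h).2.1 rfl
    have hgraph : G ⊔ fromEdgeSet ((insert s(u, v) P : Finset (Sym2 V)) : Set (Sym2 V)) =
        G ⊔ fromEdgeSet {s(u, v)} ⊔ fromEdgeSet (P : Set (Sym2 V)) := by
      rw [sup_assoc, ← fromEdgeSet_union, Finset.coe_insert, Set.singleton_union]
    refine ⟨insert s(u, v) P, by rw [Finset.card_insert_of_notMem huP, hPc], ?_, ?_, ?_, ?_⟩
    · simpa [huv] using hPd
    · intro e he x hx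
      rcases Finset.mem_insert.1 he with rfl | he
      · rcases Sym2.mem_iff.1 hx with rfl | rfl <;> assumption
      · exact (Finset.mem_sdiff.1 (hPU e he x hx)).1
    · intro x hx
      by_cases hxu : x = u
      · subst hxu
        refine ⟨v, Finset.mem_insert_self _ _, fun y hy => ?_⟩
        rcases Finset.mem_insert.1 hy with h | h
        · exact Sym2.congr_right.1 h
        · exact absurd rfl (hmem h).2.1
      by_cases hxv : x = v
      · subst hxv
        refine ⟨u, Finset.mem_insert.2 (Or.inl Sym2.eq_swap), fun y hy => ?_⟩
        rcases Finset.mem_insert.1 hy with h | h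
        · exact Sym2.congr_right.1 (h.trans Sym2.eq_swap)
        · exact absurd rfl (hmem h).2.2
      obtain ⟨y, hy, huniq⟩ := hPm x (by simp [hx, hxu, hxv])
      refine ⟨y, Finset.mem_insert_of_mem hy, fun z hz => ?_⟩
      rcases Finset.mem_insert.1 hz with h | h
      · have : x ∈ s(u, v) := h ▸ Sym2.mem_mk_left x z
        rcases Sym2.mem_iff.1 this with rfl | rfl <;> contradiction
      · exact huniq z h
    · rw [hgraph]
      have huv' : (G ⊔ fromEdgeSet {s(u, v)} ⊔ fromEdgeSet (P : Set (Sym2 V))).Reachable v u :=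
        Adj.reachable (Or.inl (Or.inr (by simpa [Sym2.eq_swap] using huv.symm)))
      have hto : ∀ x ∈ U,
          (G ⊔ fromEdgeSet {s(u, v)} ⊔ fromEdgeSet (P : Set (Sym2 V))).Reachable x u := by
        intro x hx
        by_cases hxu : x = u
        · rw [hxu]
        by_cases hxv : x = v
        · rwa [hxv]
        rcases hw with hw | ⟨w, hw, huw⟩
        · have := hw hx
          simp [hxu, hxv] at this
        · exact (hPr x (by simp [hx, hxu, hxv]) w hw).trans
            (huw.symm.mono (le_sup_left.trans le_sup_left))
      exact fun x hx y hy => (hto x hx).trans (hto y hy).symm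

lemma deficiency_div_two_add_cZero_mem_optSet [Fintype V] (heven : Even (Fintype.card V))
    (hdef : 0 < deficiency H) (hge : 2 * cPlus H ≤ deficiency H) :
    deficiency H / 2 + cZero H ∈ optSet H := by
  classical
  obtain ⟨M, hM, hmax⟩ := H.exists_isMatching_ncard_verts_eq
  set U : Finset V := Finset.univ.filter (· ∉ M.verts) with hUdef
  have hmemU : ∀ v, v ∈ U ↔ v ∉ M.verts := by simp [hUdef]
  have hUc : U.card = deficiency H := by
    have h := Set.ncard_add_ncard_compl M.verts
    have : M.vertsᶜ.ncard = U.card := by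
      rw [← Set.ncard_coe_finset]
      congr 1
      ext v
      simp [hUdef]
    rw [Nat.card_eq_fintype_card] at h
    unfold deficiency
    omega
  have hUeven : U.card = 2 * (deficiency H / 2) := by
    obtain ⟨k, hk⟩ := heven
    rw [hUc]
    unfold deficiency
    omega
  have hpos : ∀ u ∈ U, compDeficiency H (H.connectedComponentMk u) ≠ 0 := fun u hu h =>
    (hmemU u).1 hu (hM.mem_verts_of_compDeficiency_eq_zero hmax h)
  have himage : (U.image H.connectedComponentMk).card ≤ cPlus H := by
    rw [cPlus, Nat.card_eq_fintype_card, Fintype.card_subtype]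
    refine Finset.card_le_card fun C hC => ?_
    obtain ⟨u, hu, rfl⟩ := Finset.mem_image.1 hC
    simpa [Nat.pos_iff_ne_zero] using hpos u hu
  obtain ⟨P, hPc, hPd, hPU, hPm, hPr⟩ := exists_pairing_reachable _ H U hUeven (by omega)
  obtain ⟨u₀, hu₀⟩ : U.Nonempty := Finset.card_pos.1 (by omega)
  choose r hr using fun K : H.ConnectedComponent => K.exists_rep
  replace hr : ∀ K, H.connectedComponentMk (r K) = K := hr
  set Z : Finset H.ConnectedComponent := Finset.univ.filter (compDeficiency H · = 0)
  have hrU : ∀ K ∈ Z, r K ∉ U := fun K hK h =>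
    hpos _ h (by rw [hr]; exact (Finset.mem_filter.1 hK).2)
  set Q : Finset (Sym2 V) := Z.image fun K => s(r K, u₀)
  have hQc : Q.card = cZero H := by
    rw [cZero, Nat.card_eq_fintype_card, Fintype.card_subtype]
    refine Finset.card_image_of_injective _ fun K L h => ?_
    rw [← hr K, ← hr L, Sym2.congr_left.1 h]
  have hQ : ∀ e ∈ Q, ∃ K ∈ Z, s(r K, u₀) = e := fun e he => Finset.mem_image.1 he
  have hPQ : Disjoint P Q := by
    rw [Finset.disjoint_left]
    intro e heP heQ
    obtain ⟨K, hK, rfl⟩ := hQ e heQ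
    exact hrU K hK (hPU _ heP _ (Sym2.mem_mk_left _ _))
  refine ⟨P ∪ Q, ?_, ?_, ?_, ?_, by rw [Finset.card_union_of_disjoint hPQ, hPc, hQc]⟩
  · intro e he
    rcases Finset.mem_union.1 he with he | he
    · exact hPd e he
    · obtain ⟨K, hK, rfl⟩ := hQ e he
      exact fun h => hrU K hK (Sym2.mk_isDiag_iff.1 h ▸ hu₀)
  · intro e he
    rcases Finset.mem_union.1 he with he | he
    · induction e using Sym2.ind with
      | _ a b =>
        exact hM.not_adj_of_notMem_verts hmax
          ((hmemU a).1 (hPU _ he a (Sym2.mem_mk_left _ _)))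
          ((hmemU b).1 (hPU _ he b (Sym2.mem_mk_right _ _)))
    · obtain ⟨K, hK, rfl⟩ := hQ e he
      intro h
      have h' : H.connectedComponentMk (r K) = H.connectedComponentMk u₀ :=
        ConnectedComponent.sound (Adj.reachable h)
      refine hpos u₀ hu₀ ?_
      rw [← h', hr]
      exact (Finset.mem_filter.1 hK).2
  · have hle : H ⊔ fromEdgeSet (P : Set (Sym2 V)) ≤
        H ⊔ fromEdgeSet ((P ∪ Q : Finset (Sym2 V)) : Set (Sym2 V)) :=
      sup_le_sup_left (fromEdgeSet_mono (by simp)) _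
    have hto : ∀ x,
        (H ⊔ fromEdgeSet ((P ∪ Q : Finset (Sym2 V)) : Set (Sym2 V))).Reachable x u₀ := by
      intro x
      by_cases hx : compDeficiency H (H.connectedComponentMk x) = 0
      · have hK : H.connectedComponentMk x ∈ Z := by simpa [Z] using hx
        have h1 : H.Reachable x (r (H.connectedComponentMk x)) :=
          ConnectedComponent.exact (hr _).symm
        refine (h1.mono le_sup_left).trans (Adj.reachable (Or.inr ?_))
        rw [fromEdgeSet_adj]
        refine ⟨Finset.mem_coe.2 (Finset.mem_union_right _ (Finset.mem_image.2 ⟨_, hK, rfl⟩)), ?_⟩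
        exact fun h => hrU _ hK (h ▸ hu₀)
      · obtain ⟨u, huK, hu⟩ := Set.not_subset.1 (mt hM.compDeficiency_eq_zero_of_subset hx)
        have h1 : H.Reachable u x := ConnectedComponent.exact huK
        exact (h1.symm.mono le_sup_left).trans ((hPr u ((hmemU u).2 hu) u₀ hu₀).mono hle)
    have : Nonempty V := ⟨u₀⟩
    exact ⟨fun x y => (hto x).trans (hto y).symm⟩
  · refine ⟨⟨Set.univ, fun a b => M.Adj a b ∨ s(a, b) ∈ P, ?_, fun _ => Set.mem_univ _,
      ⟨fun a b h => h.imp (fun h => h.symm) fun h => Sym2.eq_swap ▸ h⟩⟩,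
      Subgraph.isPerfectMatching_iff.2 fun v => ?_⟩
    · rintro a b (h | h)
      · exact Or.inl (M.adj_sub h)
      · right
        rw [fromEdgeSet_adj]
        exact ⟨Finset.mem_coe.2 (Finset.mem_union_left _ h),
          fun hab => hPd _ h (Sym2.mk_isDiag_iff.2 hab)⟩
    · by_cases hv : v ∈ M.verts
      · obtain ⟨w, hw, huniq⟩ := hM hv
        refine ⟨w, Or.inl hw, ?_⟩
        rintro y (hy | hy)
        · exact huniq y hy
        · exact absurd hv ((hmemU v).1 (hPU _ hy v (Sym2.mem_mk_left _ _)))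
      · obtain ⟨w, hw, huniq⟩ := hPm v ((hmemU v).2 hv)
        refine ⟨w, Or.inr hw, ?_⟩
        rintro y (hy | hy)
        · exact absurd (M.edge_vert hy) hv
        · exact huniq y hy

end SimpleGraph

/-- Lemma 2, Statement 2b. Let `H` be a finite simple graph on an even
vertex set with `def(H) > 0` and `(1/2)·def(H) ≥ c₊(H)` (equivalently `def(H) ≥ 2·c₊(H)`).
Then `opt(H) = (1/2)·def(H) + c₀(H)`.  (Since the vertex set has even cardinality, the
deficiency is even and `deficiency H / 2` is exact division.) -/
theorem augPMST_case_2b {V : Type*} [Fintype V] (H : SimpleGraph V)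
    (heven : Even (Fintype.card V))
    (hdef : 0 < deficiency H) (hge : 2 * cPlus H ≤ deficiency H) :
    IsLeast (optSet H) (deficiency H / 2 + cZero H) := by
  refine ⟨SimpleGraph.deficiency_div_two_add_cZero_mem_optSet heven hdef hge, ?_⟩
  rintro _ ⟨F, -, -, hconn, hpm, rfl⟩
  exact SimpleGraph.deficiency_div_two_add_cZero_le hdef F hconn hpm
end

section
/- Let H be a finite simple graph and let u, v be distinct non-adjacent vertices of H. If every maximum matching of H covers u or covers v, then the maximum matching size of the graph obtained from H by adding the edge {u, v} equals the maximum matching size of H (equivalently, the deficiency is unchanged). -/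
namespace SimpleGraph.Subgraph

variable {V : Type*} {G H : SimpleGraph V}

/-- A matching of `G` all of whose edges are edges of `H` is a matching of `H`. -/
theorem IsMatching.exists_of_adj_le {M : G.Subgraph} (hM : M.IsMatching)
    (h : ∀ ⦃a b⦄, M.Adj a b → H.Adj a b) :
    ∃ N : H.Subgraph, N.IsMatching ∧ N.verts = M.verts ∧ N.edgeSet = M.edgeSet := by
  refine ⟨⟨M.verts, M.Adj, fun hab => h hab, fun hab => M.edge_vert hab, M.symm⟩, hM, rfl, ?_⟩
  ext e
  induction e with
  | _ a b => rfl

/-- Removing both endpoints of an edge of a matching leaves a matching. -/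
theorem IsMatching.deleteVerts_pair {M : G.Subgraph} (hM : M.IsMatching) {u v : V}
    (huv : M.Adj u v) : (M.deleteVerts {u, v}).IsMatching := by
  intro w hw
  simp only [deleteVerts_verts, Set.mem_sdiff, Set.mem_insert_iff, Set.mem_singleton_iff,
    not_or] at hw
  obtain ⟨hw, hwu, hwv⟩ := hw
  obtain ⟨x, hx, hx'⟩ := hM hw
  refine ⟨x, ?_, fun y hy => hx' y (M.deleteVerts_le.2 hy)⟩
  have hxu : x ≠ u := by
    rintro rfl
    exact hwv (hM.eq_of_adj_left hx.symm huv)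
  have hxv : x ≠ v := by
    rintro rfl
    exact hwu (hM.eq_of_adj_left hx.symm huv.symm)
  simp [hw, hwu, hwv, hxu, hxv, hx, M.edge_vert hx.symm]

/-- Removing both endpoints of an edge of a matching removes at most that edge. -/
theorem IsMatching.edgeSet_subset_insert_deleteVerts_pair {M : G.Subgraph} (hM : M.IsMatching)
    {u v : V} (huv : M.Adj u v) :
    M.edgeSet ⊆ insert s(u, v) (M.deleteVerts {u, v}).edgeSet := by
  intro e he
  induction e with
  | _ a b =>
    have hab : M.Adj a b := he
    by_cases hau : a = u
    · subst hau
      exact Or.inl (by rw [hM.eq_of_adj_left hab huv])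
    by_cases hav : a = v
    · subst hav
      exact Or.inl (by rw [hM.eq_of_adj_left hab huv.symm, Sym2.eq_swap])
    have hbu : b ≠ u := by
      rintro rfl
      exact hav (hM.eq_of_adj_left hab.symm huv)
    have hbv : b ≠ v := by
      rintro rfl
      exact hau (hM.eq_of_adj_left hab.symm huv.symm)
    right
    simp [hau, hav, hbu, hbv, hab, M.edge_vert hab, M.edge_vert hab.symm]

end SimpleGraph.Subgraph

section maxMatchingCard

variable {V : Type*}

theorem SimpleGraph.Subgraph.IsMatching.ncard_edgeSet_le_maxMatchingCard [Finite V]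
    {H : SimpleGraph V} {M : H.Subgraph} (hM : M.IsMatching) :
    M.edgeSet.ncard ≤ maxMatchingCard H := by
  refine le_csSup ⟨(Set.univ : Set (Sym2 V)).ncard, ?_⟩ ⟨M, hM, rfl⟩
  rintro _ ⟨N, -, rfl⟩
  exact Set.ncard_le_ncard (Set.subset_univ _)

theorem maxMatchingCard_le {H : SimpleGraph V} {n : ℕ}
    (h : ∀ M : H.Subgraph, M.IsMatching → M.edgeSet.ncard ≤ n) : maxMatchingCard H ≤ n := by
  refine csSup_le ⟨_, ⊥, fun _ hx => hx.elim, rfl⟩ ?_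
  rintro _ ⟨M, hM, rfl⟩
  exact h M hM

theorem maxMatchingCard_mono [Finite V] {G H : SimpleGraph V} (h : G ≤ H) :
    maxMatchingCard G ≤ maxMatchingCard H := by
  refine maxMatchingCard_le fun M hM => ?_
  obtain ⟨N, hN, -, hNM⟩ := hM.exists_of_adj_le fun _ _ hab => h hab.adj_sub
  exact hNM ▸ hN.ncard_edgeSet_le_maxMatchingCard

end maxMatchingCard

/-- Let `H` be a finite simple graph and `u, v` distinct non-adjacent
vertices.  If every maximum matching of `H` covers `u` or covers `v`, then adding the edge
`{u, v}` leaves the maximum matching size unchanged (equivalently, the deficiency is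
unchanged). -/
theorem addEdge_covered_maxMatching {V : Type*} [Fintype V] (H : SimpleGraph V)
    (u v : V) (huv : u ≠ v) (hadj : ¬ H.Adj u v)
    (hcov : ∀ M : H.Subgraph, M.IsMatching →
      (∀ M' : H.Subgraph, M'.IsMatching → M'.edgeSet.ncard ≤ M.edgeSet.ncard) →
      u ∈ M.verts ∨ v ∈ M.verts) :
    maxMatchingCard (H ⊔ SimpleGraph.fromEdgeSet {s(u, v)}) = maxMatchingCard H := by
  refine le_antisymm (maxMatchingCard_le fun M hM => ?_) (maxMatchingCard_mono le_sup_left)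
  have hH : ∀ ⦃a b⦄, M.Adj a b → s(a, b) ≠ s(u, v) → H.Adj a b := by
    intro a b hab hne
    rcases hab.adj_sub with h | h
    · exact h
    · exact absurd ((SimpleGraph.fromEdgeSet_adj _).1 h).1 hne
  by_cases hM_uv : M.Adj u v
  · have hdel : ∀ ⦃a b⦄, (M.deleteVerts {u, v}).Adj a b → H.Adj a b := by
      intro a b hab
      refine hH (SimpleGraph.Subgraph.deleteVerts_le.2 hab) fun he => ?_
      rw [SimpleGraph.Subgraph.deleteVerts_adj] at hab
      have ha : a ∈ s(u, v) := he ▸ Sym2.mem_mk_left a b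
      exact hab.2.1 (by simpa using ha)
    obtain ⟨N, hN, hNv, hNe⟩ := (hM.deleteVerts_pair hM_uv).exists_of_adj_le hdel
    have hcard : M.edgeSet.ncard ≤ N.edgeSet.ncard + 1 := by
      rw [hNe]
      exact (Set.ncard_le_ncard (hM.edgeSet_subset_insert_deleteVerts_pair hM_uv)).trans
        (Set.ncard_insert_le _ _)
    obtain ⟨M', hM', hlt⟩ : ∃ M' : H.Subgraph, M'.IsMatching ∧
        N.edgeSet.ncard < M'.edgeSet.ncard := by
      by_contra! hmax
      have := hcov N hN hmax
      simp [hNv] at this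
    exact hcard.trans (Nat.succ_le_of_lt hlt |>.trans hM'.ncard_edgeSet_le_maxMatchingCard)
  · obtain ⟨N, hN, -, hNM⟩ := hM.exists_of_adj_le fun a b hab => hH hab fun he => by
      rw [← SimpleGraph.Subgraph.mem_edgeSet, he] at hab
      exact hM_uv hab
    exact hNM ▸ hN.ncard_edgeSet_le_maxMatchingCard
end

section
/- Let H be a finite simple graph, let u, v be distinct non-adjacent vertices lying in distinct connected components K_1 and K_2 of H, and suppose def(K_1) ≥ 1 and def(K_2) ≥ 1. Then adding the edge {u, v} to H yields a graph whose number of connected components is c(H) - 1; moreover, if additionally some maximum matching of H exposes both u and v, then the deficiency of the new graph is def(H) - 2. -/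
namespace SimpleGraph

variable {V : Type*} {H : SimpleGraph V} {u v : V}

theorem Subgraph.IsMatching.ncard_le_maxMatchingCard [Finite V] {M : H.Subgraph}
    (hM : M.IsMatching) : M.edgeSet.ncard ≤ maxMatchingCard H := by
  refine le_csSup ⟨Nat.card (Sym2 V), ?_⟩ ⟨M, hM, rfl⟩
  rintro n ⟨N, -, rfl⟩
  exact Set.ncard_le_card _

theorem maxMatchingCard_le {m : ℕ}
    (h : ∀ M : H.Subgraph, M.IsMatching → M.edgeSet.ncard ≤ m) : maxMatchingCard H ≤ m := by
  refine csSup_le ⟨_, ⊥, fun _ hx => hx.elim, rfl⟩ ?_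
  rintro n ⟨M, hM, rfl⟩
  exact h M hM

theorem maxMatchingCard_sup_edge_le [Finite V] :
    maxMatchingCard (H ⊔ edge u v) ≤ maxMatchingCard H + 1 := by
  refine maxMatchingCard_le fun M hM => ?_
  let N : H.Subgraph :=
    { verts := {a | ∃ b, M.Adj a b ∧ H.Adj a b}
      Adj := fun a b => M.Adj a b ∧ H.Adj a b
      adj_sub := And.right
      edge_vert := fun h => ⟨_, h⟩
      symm := ⟨fun _ _ h => ⟨h.1.symm, h.2.symm⟩⟩ }
  have hN : N.IsMatching := by
    rintro a ⟨b, hb⟩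
    exact ⟨b, hb, fun c hc => hM.eq_of_adj_left hc.1 hb.1⟩
  have hsub : M.edgeSet ⊆ insert s(u, v) N.edgeSet := by
    intro e
    induction e using Sym2.ind with
    | _ a b =>
      intro hab
      rcases M.adj_sub hab with h | h
      · exact Or.inr ⟨hab, h⟩
      · exact Or.inl ((adj_edge ..).1 h).1.symm
  calc M.edgeSet.ncard ≤ (insert s(u, v) N.edgeSet).ncard := Set.ncard_le_ncard hsub
    _ ≤ N.edgeSet.ncard + 1 := Set.ncard_insert_le _ _
    _ ≤ maxMatchingCard H + 1 := Nat.add_le_add_right hN.ncard_le_maxMatchingCard 1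

theorem Subgraph.IsMatching.ncard_add_one_le_maxMatchingCard_sup_edge [Finite V]
    {M : H.Subgraph} (hM : M.IsMatching) (huv : u ≠ v) (hu : u ∉ M.verts) (hv : v ∉ M.verts) :
    M.edgeSet.ncard + 1 ≤ maxMatchingCard (H ⊔ edge u v) := by
  have hadj : (H ⊔ edge u v).Adj u v := Or.inr ((adj_edge ..).2 ⟨rfl, huv⟩)
  let M₁ := M.map (Hom.ofLE (le_sup_left : H ≤ H ⊔ edge u v))
  have hM₁ : M₁.IsMatching := hM.map_ofLE le_sup_left
  have hverts : M₁.verts = M.verts := by simp [M₁]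
  have hedges : M₁.edgeSet = M.edgeSet := by simp [M₁]
  have hN : (M₁ ⊔ (H ⊔ edge u v).subgraphOfAdj hadj).IsMatching := by
    refine hM₁.sup (.subgraphOfAdj hadj) ?_
    rw [hM₁.support_eq_verts, (IsMatching.subgraphOfAdj hadj).support_eq_verts, hverts]
    simp [Set.disjoint_right, hu, hv]
  have hnot : s(u, v) ∉ M.edgeSet := fun h => hu (M.edge_vert h)
  have key := hN.ncard_le_maxMatchingCard
  rwa [edgeSet_sup, edgeSet_subgraphOfAdj, hedges, Set.union_singleton,
    Set.ncard_insert_of_notMem hnot] at key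

/-- Joining two components by an edge leaves one component for each component of `H` other than
that of `v`. -/
theorem card_connectedComponent_sup_edge [Finite V]
    (h : H.connectedComponentMk u ≠ H.connectedComponentMk v) :
    Nat.card (H ⊔ edge u v).ConnectedComponent = Nat.card H.ConnectedComponent - 1 := by
  classical
  have huv : u ≠ v := fun e => h (e ▸ rfl)
  let f : V → {c : H.ConnectedComponent // c ≠ H.connectedComponentMk v} := fun x =>
    if hx : H.connectedComponentMk x = H.connectedComponentMk v then
      ⟨H.connectedComponentMk u, h⟩ else ⟨H.connectedComponentMk x, hx⟩
  have hfv : f v = f u := by simp [f]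
  have hfadj : ∀ x y, (H ⊔ edge u v).Adj x y → f x = f y := by
    rintro x y (hxy | hxy)
    · simp only [f, ConnectedComponent.connectedComponentMk_eq_of_adj hxy]
    · rcases ((edge_adj ..).1 hxy).1 with ⟨rfl, rfl⟩ | ⟨rfl, rfl⟩
      exacts [hfv.symm, hfv]
  have hfreach : ∀ x y, (H ⊔ edge u v).Walk x y → f x = f y := by
    intro x y p
    induction p with
    | nil => rfl
    | cons hxy _ ih => exact (hfadj _ _ hxy).trans ih
  have hmk : (H ⊔ edge u v).connectedComponentMk u = (H ⊔ edge u v).connectedComponentMk v :=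
    ConnectedComponent.connectedComponentMk_eq_of_adj (Or.inr ((adj_edge ..).2 ⟨rfl, huv⟩))
  let g : {c : H.ConnectedComponent // c ≠ H.connectedComponentMk v} →
      (H ⊔ edge u v).ConnectedComponent := fun c => c.1.map (Hom.ofLE le_sup_left)
  have hgf : ∀ x, g (f x) = (H ⊔ edge u v).connectedComponentMk x := by
    intro x
    by_cases hx : H.connectedComponentMk x = H.connectedComponentMk v
    · have := congrArg (ConnectedComponent.map (Hom.ofLE (le_sup_left : H ≤ H ⊔ edge u v))) hx
      simp only [f, g, dif_pos hx]
      exact hmk.trans this.symm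
    · simp only [f, g, dif_neg hx]
      rfl
  let e : (H ⊔ edge u v).ConnectedComponent ≃
      {c : H.ConnectedComponent // c ≠ H.connectedComponentMk v} :=
    { toFun := ConnectedComponent.lift f fun x y p _ => hfreach x y p
      invFun := g
      left_inv := ConnectedComponent.ind hgf
      right_inv := by
        rintro ⟨c, hc⟩
        induction c using ConnectedComponent.ind with
        | _ x => exact dif_neg hc }
  rw [Nat.card_congr e]
  have := Fintype.ofFinite H.ConnectedComponent
  simp [Nat.card_eq_fintype_card, Fintype.card_subtype_compl]

end SimpleGraph

/-- Let `u, v` be distinct non-adjacent vertices of a finite simple graph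
`H` lying in distinct connected components `K₁, K₂` with `def(K₁) ≥ 1` and `def(K₂) ≥ 1`.
Then adding the edge `{u, v}` decreases the number of connected components by exactly one;
moreover, if some maximum matching of `H` exposes both `u` and `v`, then the deficiency of
the new graph is `def(H) - 2`. -/
theorem addEdge_between_deficient_components {V : Type*} [Fintype V] (H : SimpleGraph V)
    (u v : V) (huv : u ≠ v) (hadj : ¬ H.Adj u v)
    (hcomp : H.connectedComponentMk u ≠ H.connectedComponentMk v)
    (hd1 : 1 ≤ compDeficiency H (H.connectedComponentMk u))
    (hd2 : 1 ≤ compDeficiency H (H.connectedComponentMk v)) :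
    Nat.card (H ⊔ SimpleGraph.fromEdgeSet {s(u, v)}).ConnectedComponent =
        Nat.card H.ConnectedComponent - 1 ∧
      ((∃ M : H.Subgraph, M.IsMatching ∧
          (∀ M' : H.Subgraph, M'.IsMatching → M'.edgeSet.ncard ≤ M.edgeSet.ncard) ∧
          u ∉ M.verts ∧ v ∉ M.verts) →
        deficiency (H ⊔ SimpleGraph.fromEdgeSet {s(u, v)}) = deficiency H - 2) := by
  refine ⟨SimpleGraph.card_connectedComponent_sup_edge hcomp, ?_⟩
  rintro ⟨M, hM, hmax, hu, hv⟩
  have h₁ := SimpleGraph.maxMatchingCard_le hmax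
  have h₂ := hM.ncard_add_one_le_maxMatchingCard_sup_edge huv hu hv
  have h₃ := SimpleGraph.maxMatchingCard_sup_edge_le (H := H) (u := u) (v := v)
  rw [SimpleGraph.edge] at h₂ h₃
  rw [deficiency, deficiency]
  lia
end

section
/- Let A and B be disjoint finite sets with |A| = |B| = n ≥ 1, and let H be a bipartite simple graph on vertex set A ∪ B in which every edge joins a vertex of A to a vertex of B. Let opt'(H) be the minimum cardinality of a set F of pairs {a, b} with a ∈ A, b ∈ B that are not edges of H such that adding the edges of F to H yields a connected graph with a perfect matching. Then opt'(H) = c(H) - 1 if def(H) = 0 or (1/2)·def(H) < c_+(H), and opt'(H) = (1/2)·def(H) + c_0(H) if def(H) > 0 and (1/2)·def(H) ≥ c_+(H). -/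
/-- The set of cardinalities of sets `F` of non-edges of `H` joining a vertex of `A` to a
vertex of `B` whose addition makes `H` connected and perfectly matchable.  Its least
element is `opt'(H)`. -/
def optSetBip {V : Type*} (H : SimpleGraph V) (A B : Set V) : Set ℕ :=
  {n : ℕ | ∃ F : Finset (Sym2 V),
    (∀ e ∈ F, ∃ a ∈ A, ∃ b ∈ B, e = s(a, b)) ∧ (∀ e ∈ F, e ∉ H.edgeSet) ∧
    (H ⊔ SimpleGraph.fromEdgeSet (↑F : Set (Sym2 V))).Connected ∧
    HasPerfectMatching (H ⊔ SimpleGraph.fromEdgeSet (↑F : Set (Sym2 V))) ∧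
    F.card = n}

open Classical in
/-- If `f` is onto and `S` contains every edge of the connected graph `G` that `f` does not
collapse, then the image of `f` has at most `|S| + 1` elements. -/
theorem card_le_card_add_one_of_connected {V W : Type*} {G : SimpleGraph V}
    (hG : G.Connected) (f : V → W) (hf : Function.Surjective f) (S : Finset (Sym2 V))
    (hS : ∀ u v, G.Adj u v → f u ≠ f v → s(u, v) ∈ S) :
    Nat.card W ≤ S.card + 1 := by
  set Q : SimpleGraph W := SimpleGraph.fromEdgeSet ↑(S.image (Sym2.map f)) with hQ
  have hstep : ∀ u v, G.Adj u v → Q.Reachable (f u) (f v) := by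
    intro u v h
    by_cases e : f u = f v
    · rw [e]
    · refine SimpleGraph.Adj.reachable ?_
      rw [hQ, SimpleGraph.fromEdgeSet_adj]
      refine ⟨?_, e⟩
      simp only [Finset.coe_image, Set.mem_image, Finset.mem_coe]
      exact ⟨s(u, v), hS u v h e, rfl⟩
  have hreach : ∀ u v, G.Reachable u v → Q.Reachable (f u) (f v) := by
    rintro u v ⟨p⟩
    induction p with
    | nil => exact SimpleGraph.Reachable.refl _
    | cons h _ ih => exact (hstep _ _ h).trans ih
  have hQc : Q.Connected := by
    have : Nonempty W := hG.nonempty.map f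
    refine ⟨fun x y => ?_⟩
    obtain ⟨u, rfl⟩ := hf x
    obtain ⟨v, rfl⟩ := hf y
    exact hreach u v (hG.preconnected u v)
  have h1 := hQc.card_vert_le_card_edgeSet_add_one
  have h2 : Nat.card Q.edgeSet ≤ S.card := by
    calc Nat.card Q.edgeSet ≤ Nat.card (↑(S.image (Sym2.map f)) : Set (Sym2 W)) := by
          refine Nat.card_mono (Finset.finite_toSet _) ?_
          rw [hQ, SimpleGraph.edgeSet_fromEdgeSet]
          exact Set.sdiff_subset
      _ = (S.image (Sym2.map f)).card := by simp
      _ ≤ S.card := Finset.card_image_le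
  omega

theorem bddAbove_matching_card {V : Type*} [Finite V] (G : SimpleGraph V) :
    BddAbove {n : ℕ | ∃ M : G.Subgraph, M.IsMatching ∧ M.edgeSet.ncard = n} := by
  refine ⟨Nat.card (Sym2 V), ?_⟩
  rintro n ⟨M, -, rfl⟩
  exact Set.ncard_le_card _

/-- An injective choice of neighbours outside `T` for the vertices of `T` is a matching with
`|T|` edges. -/
theorem card_le_maxMatchingCard {V : Type*} [Finite V] {G : SimpleGraph V} {T : Finset V}
    {φ : V → V} (hadj : ∀ x ∈ T, G.Adj x (φ x)) (hinj : Set.InjOn φ T)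
    (hout : ∀ x ∈ T, φ x ∉ T) : T.card ≤ maxMatchingCard G := by
  let M : G.Subgraph :=
    { verts := {v | v ∈ T ∨ ∃ x ∈ T, v = φ x}
      Adj := fun u v => (u ∈ T ∧ v = φ u) ∨ (v ∈ T ∧ u = φ v)
      adj_sub := by
        rintro u v (⟨h, rfl⟩ | ⟨h, rfl⟩)
        · exact hadj u h
        · exact (hadj v h).symm
      edge_vert := by
        rintro u v (⟨h, rfl⟩ | ⟨h, rfl⟩)
        · exact Or.inl h
        · exact Or.inr ⟨v, h, rfl⟩
      symm := ⟨fun u v h => h.symm⟩ }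
  have hM : M.IsMatching := by
    rintro v (hv | ⟨x, hx, rfl⟩)
    · refine ⟨φ v, Or.inl ⟨hv, rfl⟩, ?_⟩
      rintro w (⟨-, h⟩ | ⟨h, rfl⟩)
      · exact h
      · exact absurd hv (hout w h)
    · refine ⟨x, Or.inr ⟨hx, rfl⟩, ?_⟩
      rintro w (⟨h, -⟩ | ⟨h, h'⟩)
      · exact absurd h (hout x hx)
      · exact (hinj hx h h').symm
  have hcard : T.card ≤ M.edgeSet.ncard := by
    rw [← Set.ncard_coe_finset]
    refine Set.ncard_le_ncard_of_injOn (fun x => s(x, φ x)) ?_ ?_ (Set.toFinite _)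
    · intro x hx
      exact Or.inl ⟨hx, rfl⟩
    · intro x hx y hy hxy
      simp only [Sym2.eq_iff] at hxy
      rcases hxy with h | h
      · exact h.1
      · exact absurd hy (h.2 ▸ hout x hx)
  exact hcard.trans (le_csSup (bddAbove_matching_card G) ⟨M, hM, rfl⟩)

/-- A matching restricted to the vertices of `A` is an injective choice of neighbours. -/
theorem exists_injOn_of_isMatching {V : Type*} {G : SimpleGraph V} {A : Set V} {M : G.Subgraph}
    (hM : M.IsMatching) :
    ∃ φ : V → V, (∀ x ∈ A ∩ M.verts, M.Adj x (φ x)) ∧ Set.InjOn φ (A ∩ M.verts) := by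
  have : ∀ x, ∃ y, x ∈ A ∩ M.verts → M.Adj x y := by
    intro x
    by_cases h : x ∈ A ∩ M.verts
    · exact ⟨_, fun _ => (hM h.2).choose_spec.1⟩
    · exact ⟨x, fun h' => absurd h' h⟩
  choose φ hφ using this
  refine ⟨φ, hφ, fun x hx y hy hxy => ?_⟩
  exact hM.eq_of_adj_right (hφ x hx) (hxy ▸ hφ y hy)

open Classical in
/-- In a bipartite graph, a maximum matching is an injective choice of neighbours. -/
theorem exists_injOn_card_eq_maxMatchingCard {V : Type*} [Fintype V] {G : SimpleGraph V}
    {A : Set V} (hbip : ∀ u v, G.Adj u v → (u ∈ A ↔ v ∉ A)) :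
    ∃ (T : Finset V) (φ : V → V), (∀ x ∈ T, x ∈ A) ∧ (∀ x ∈ T, G.Adj x (φ x)) ∧
      Set.InjOn φ T ∧ T.card = maxMatchingCard G := by
  have hne : {n : ℕ | ∃ M : G.Subgraph, M.IsMatching ∧ M.edgeSet.ncard = n}.Nonempty :=
    ⟨_, ⊥, fun v hv => absurd hv (by simp), rfl⟩
  obtain ⟨M, hM, hcard⟩ := Nat.sSup_mem hne (bddAbove_matching_card G)
  obtain ⟨φ, hφ, hinj⟩ := exists_injOn_of_isMatching (A := A) hM
  have hmem : ∀ x, x ∈ (A ∩ M.verts).toFinset ↔ x ∈ A ∩ M.verts := fun x => Set.mem_toFinset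
  refine ⟨(A ∩ M.verts).toFinset, φ, fun x hx => ((hmem x).1 hx).1,
    fun x hx => (hφ x ((hmem x).1 hx)).adj_sub, by simpa using hinj, le_antisymm ?_ ?_⟩
  · refine card_le_maxMatchingCard (φ := φ) (fun x hx => (hφ x ((hmem x).1 hx)).adj_sub)
      (by simpa using hinj) (fun x hx hx' => ?_)
    exact (hbip _ _ (hφ x ((hmem x).1 hx)).adj_sub).1 ((hmem x).1 hx).1 ((hmem _).1 hx').1
  · change sSup _ ≤ _
    rw [← hcard]
    have hsub : M.edgeSet ⊆ ↑((A ∩ M.verts).toFinset.image fun x => s(x, φ x)) := by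
      intro e he
      induction e using Sym2.ind with
      | _ u v =>
        rw [SimpleGraph.Subgraph.mem_edgeSet] at he
        have hb := hbip u v he.adj_sub
        simp only [Finset.coe_image, Set.coe_toFinset, Set.mem_image]
        by_cases hu : u ∈ A
        · have hu' : u ∈ A ∩ M.verts := ⟨hu, he.fst_mem⟩
          exact ⟨u, hu', by rw [hM.eq_of_adj_left (hφ u hu') he]⟩
        · have hv' : v ∈ A ∩ M.verts := ⟨by tauto, he.snd_mem⟩
          exact ⟨v, hv', by rw [hM.eq_of_adj_left (hφ v hv') he.symm, Sym2.eq_swap]⟩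
    calc M.edgeSet.ncard ≤ _ := Set.ncard_le_ncard hsub (Finset.finite_toSet _)
      _ = _ := Set.ncard_coe_finset _
      _ ≤ _ := Finset.card_image_le

/-- A bijection between the two sides along edges gives a perfect matching. -/
theorem hasPerfectMatching_of_bijOn {V : Type*} {G : SimpleGraph V} {A : Set V} {ψ : V → V}
    (hψ : Set.BijOn ψ A Aᶜ) (hadj : ∀ x ∈ A, G.Adj x (ψ x)) : HasPerfectMatching G := by
  have hout : ∀ x ∈ A, ψ x ∉ A := fun x hx => hψ.mapsTo hx
  let M : G.Subgraph :=
    { verts := Set.univ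
      Adj := fun u v => (u ∈ A ∧ v = ψ u) ∨ (v ∈ A ∧ u = ψ v)
      adj_sub := by
        rintro u v (⟨h, rfl⟩ | ⟨h, rfl⟩)
        · exact hadj u h
        · exact (hadj v h).symm
      edge_vert := fun _ => trivial
      symm := ⟨fun u v h => h.symm⟩ }
  refine ⟨M, fun v _ => ?_, fun v => trivial⟩
  by_cases hv : v ∈ A
  · refine ⟨ψ v, Or.inl ⟨hv, rfl⟩, ?_⟩
    rintro w (⟨-, h⟩ | ⟨h, rfl⟩)
    · exact h
    · exact absurd hv (hout w h)
  · obtain ⟨x, hx, rfl⟩ := hψ.surjOn hv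
    refine ⟨x, Or.inr ⟨hx, rfl⟩, ?_⟩
    rintro w (⟨h, -⟩ | ⟨h, h'⟩)
    · exact absurd h (hout x hx)
    · exact (hψ.injOn hx h h').symm

theorem exists_injOn_of_hasPerfectMatching {V : Type*} {G : SimpleGraph V} (A : Set V)
    (h : HasPerfectMatching G) :
    ∃ ψ : V → V, (∀ x ∈ A, G.Adj x (ψ x)) ∧ Set.InjOn ψ A := by
  obtain ⟨M, hM, hspan⟩ := h
  obtain ⟨ψ, hψ, hinj⟩ := exists_injOn_of_isMatching (A := A) hM
  have : A ∩ M.verts = A := Set.inter_eq_left.2 fun x _ => hspan x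
  rw [this] at hψ hinj
  exact ⟨ψ, fun x hx => (hψ x hx).adj_sub, hinj⟩

open Classical in
/-- The labelling obtained from `f` by identifying the labels of `a` and `b`. -/
noncomputable def mergeLabel {V ι : Type*} (f : V → ι) (a b : V) : V → ι :=
  fun v => if f v = f b then f a else f v

theorem reachable_of_mergeLabel_eq {V ι : Type*} {f : V → ι} {a b : V} {G : SimpleGraph V}
    (hf : ∀ u v, f u = f v → G.Reachable u v) (hab : G.Reachable a b) (u v : V)
    (h : mergeLabel f a b u = mergeLabel f a b v) : G.Reachable u v := by
  unfold mergeLabel at h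
  split_ifs at h with h1 h2 h2
  · exact hf _ _ (h1.trans h2.symm)
  · exact ((hf _ _ h1).trans hab.symm).trans (hf _ _ h)
  · exact ((hf _ _ h).trans hab).trans (hf _ _ h2.symm)
  · exact hf _ _ h

open Classical in
theorem image_mergeLabel_subset {V ι : Type*} [Fintype V] {f : V → ι} {a b : V}
    (hab : f a ≠ f b) :
    Finset.univ.image (mergeLabel f a b) ⊆ (Finset.univ.image f).erase (f b) := by
  intro l hl
  simp only [Finset.mem_image, Finset.mem_univ, true_and] at hl
  obtain ⟨v, rfl⟩ := hl
  simp only [Finset.mem_erase, Finset.mem_image, Finset.mem_univ, true_and]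
  unfold mergeLabel
  split_ifs with h
  · exact ⟨hab, a, rfl⟩
  · exact ⟨h, v, rfl⟩

open Classical in
theorem card_image_mergeLabel_lt {V ι : Type*} [Fintype V] {f : V → ι} {a b : V}
    (hab : f a ≠ f b) :
    (Finset.univ.image (mergeLabel f a b)).card + 1 ≤ (Finset.univ.image f).card := by
  have h1 := Finset.card_le_card (image_mergeLabel_subset hab)
  have h2 : f b ∈ Finset.univ.image f := Finset.mem_image_of_mem _ (Finset.mem_univ b)
  have h3 := Finset.card_erase_add_one h2
  omega

open Classical in
/-- The classes of a labelling with `k` labels can be linked by `k - 1` pairs between two sets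
covering everything. -/
theorem exists_linking_pairs {V ι : Type*} [Fintype V] {A B : Set V} (hA : A.Nonempty)
    (hB : B.Nonempty) (hcover : A ∪ B = Set.univ) (k : ℕ) (f : V → ι)
    (hk : (Finset.univ.image f).card ≤ k) :
    ∃ F : Finset (Sym2 V), (∀ e ∈ F, ∃ a ∈ A, ∃ b ∈ B, e = s(a, b)) ∧ F.card + 1 ≤ k ∧
      ∀ G : SimpleGraph V, (∀ u v, f u = f v → G.Reachable u v) →
        (∀ a b, s(a, b) ∈ F → G.Reachable a b) → G.Preconnected := by
  obtain ⟨a₀, ha₀⟩ := hA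
  obtain ⟨b₀, hb₀⟩ := hB
  induction k generalizing f with
  | zero =>
    have : f a₀ ∈ Finset.univ.image f := Finset.mem_image_of_mem _ (Finset.mem_univ a₀)
    have := Finset.card_pos.2 ⟨_, this⟩
    omega
  | succ k ih =>
    by_cases h : ∀ a ∈ A, ∀ b ∈ B, f a = f b
    · refine ⟨∅, by simp, by simp, fun G hG _ u v => hG u v ?_⟩
      have hconst : ∀ u, f u = f a₀ := by
        intro u
        rcases (hcover ▸ Set.mem_univ u : u ∈ A ∪ B) with hu | hu
        · rw [h u hu b₀ hb₀, h a₀ ha₀ b₀ hb₀]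
        · exact (h a₀ ha₀ u hu).symm
      rw [hconst u, hconst v]
    · push Not at h
      obtain ⟨a, ha, b, hb, hab⟩ := h
      have := card_image_mergeLabel_lt hab
      obtain ⟨F, hF, hcard, hG⟩ := ih (mergeLabel f a b) (by omega)
      refine ⟨insert s(a, b) F, ?_, ?_, fun G h1 h2 => ?_⟩
      · intro e he
        rcases Finset.mem_insert.1 he with rfl | he
        · exact ⟨a, ha, b, hb, rfl⟩
        · exact hF e he
      · have := Finset.card_insert_le s(a, b) F
        omega
      · exact hG G (reachable_of_mergeLabel_eq h1 (h2 a b (Finset.mem_insert_self _ _)))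
          fun u v h => h2 u v (Finset.mem_insert_of_mem h)

open Classical in
/-- The labels of `f` carried by no vertex of `S`. -/
noncomputable def freeLabels {V ι : Type*} [Fintype V] (f : V → ι) (S : Finset V) : Finset ι :=
  Finset.univ.image f \ S.image f

open Classical in
theorem card_image_le_card_freeLabels_add_one {V ι : Type*} [Fintype V] {f : V → ι}
    {S : Finset V} {l : ι} (h : ∀ x ∈ S, f x = l) :
    (Finset.univ.image f).card ≤ (freeLabels f S).card + 1 := by
  have h1 : (S.image f).card ≤ 1 := by
    refine (Finset.card_le_card (t := {l}) ?_).trans (by simp)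
    intro y hy
    obtain ⟨x, hx, rfl⟩ := Finset.mem_image.1 hy
    simpa using h x hx
  have := Finset.le_card_sdiff (S.image f) (Finset.univ.image f)
  unfold freeLabels
  omega

open Classical in
theorem freeLabels_mergeLabel_subset {V ι : Type*} [Fintype V] {f : V → ι} {a b : V}
    {X Y : Finset V} (hab : f a ≠ f b) :
    freeLabels (mergeLabel f a b) (X.erase a ∪ Y.erase b) ⊆
      insert (f a) (freeLabels f (X ∪ Y)) := by
  intro l hl
  obtain ⟨hl1, hl2⟩ := Finset.mem_sdiff.1 hl
  have hl3 := Finset.mem_erase.1 (image_mergeLabel_subset hab hl1)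
  rw [Finset.mem_insert, or_iff_not_imp_left]
  intro hla
  refine Finset.mem_sdiff.2 ⟨hl3.2, fun hl4 => hl2 ?_⟩
  obtain ⟨w, hw, rfl⟩ := Finset.mem_image.1 hl4
  refine Finset.mem_image.2 ⟨w, ?_, by simp [mergeLabel, hl3.1]⟩
  have hwa : w ≠ a := fun h => hla (h ▸ rfl)
  have hwb : w ≠ b := fun h => hl3.1 (h ▸ rfl)
  simpa [hwa, hwb] using hw

open Classical in
theorem freeLabels_mergeLabel_subset_of_mem {V ι : Type*} [Fintype V] {f : V → ι} {a b z : V}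
    {X Y : Finset V} (hab : f a ≠ f b) (hz : z ∈ X.erase a ∪ Y.erase b)
    (hzl : f z = f a ∨ f z = f b) :
    freeLabels (mergeLabel f a b) (X.erase a ∪ Y.erase b) ⊆ freeLabels f (X ∪ Y) := by
  intro l hl
  rcases Finset.mem_insert.1 (freeLabels_mergeLabel_subset hab hl) with rfl | h
  · refine absurd (Finset.mem_image.2 ⟨z, hz, ?_⟩) (Finset.mem_sdiff.1 hl).2
    unfold mergeLabel
    split_ifs with h
    · rfl
    · exact hzl.resolve_right h
  · exact h

open Classical in
/-- Either all labels on `X ∪ Y` agree, or two elements with different labels can be paired off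
so that one of their labels occurs again, or all labels on `X ∪ Y` are different. -/
theorem label_trichotomy {V ι : Type*} (f : V → ι) {X Y : Finset V} (hX : X.Nonempty)
    (hY : Y.Nonempty) :
    (∃ l, ∀ x ∈ X ∪ Y, f x = l) ∨
      (∃ a ∈ X, ∃ b ∈ Y, f a ≠ f b ∧
        ∃ z ∈ X.erase a ∪ Y.erase b, f z = f a ∨ f z = f b) ∨
      Set.InjOn f ↑(X ∪ Y) := by
  by_contra! hcon
  obtain ⟨hconst, hrep, hinj⟩ := hcon
  obtain ⟨a₀, ha₀⟩ := hX
  obtain ⟨b₀, hb₀⟩ := hY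
  have hcross : ∀ a ∈ X, ∀ b ∈ Y, f a ≠ f b := by
    intro a ha b hb hab
    have h1 : ∀ y ∈ Y, f y = f a := by
      intro y hy
      by_contra hne
      refine (hrep a ha y hy (Ne.symm hne) b ?_).1 hab.symm
      have : b ≠ y := fun h => hne (h ▸ hab.symm)
      simp [this, hb]
    have h2 : ∀ x ∈ X, f x = f a := by
      intro x hx
      by_contra hne
      refine (hrep x hx b hb (hab ▸ hne) a ?_).2 hab
      have : a ≠ x := fun h => hne (h ▸ rfl)
      simp [this, ha]
    obtain ⟨x, hx, hne⟩ := hconst (f a)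
    rcases Finset.mem_union.1 hx with hx | hx
    · exact hne (h2 x hx)
    · exact hne (h1 x hx)
  refine hinj fun x hx y hy hxy => ?_
  by_contra hne
  rw [Finset.mem_coe, Finset.mem_union] at hx hy
  rcases hx with hx | hx <;> rcases hy with hy | hy
  · exact (hrep x hx b₀ hb₀ (hcross x hx b₀ hb₀) y (by simp [Ne.symm hne, hy])).1 hxy.symm
  · exact hcross x hx y hy hxy
  · exact hcross y hy x hx hxy.symm
  · exact (hrep a₀ ha₀ x hx (hcross a₀ ha₀ x hx) y (by simp [Ne.symm hne, hy])).2 hxy.symm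

open Classical in
theorem bijOn_update {V : Type*} {X Y : Finset V} {a b : V} (ha : a ∈ X) (hb : b ∈ Y)
    {σ : V → V} (hσ : Set.BijOn σ ↑(X.erase a) ↑(Y.erase b)) :
    Set.BijOn (Function.update σ a b) X Y := by
  have h1 : Set.BijOn (Function.update σ a b) ↑(X.erase a) ↑(Y.erase b) := by
    refine hσ.congr fun x hx => ?_
    have : x ≠ a := (Finset.mem_erase.1 hx).1
    simp [this]
  have h2 := h1.insert (a := a) (by simp)
  rw [Function.update_self, ← Finset.coe_insert, ← Finset.coe_insert, Finset.insert_erase ha,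
    Finset.insert_erase hb] at h2
  exact h2

open Classical in
/-- Two disjoint nonempty finite sets of equal size `d` in a labelled set can be matched so that
identifying labels along the pairs lowers the number of labels by `d`, or merges all labels that
occur on these sets. -/
theorem exists_merging_bijOn {V ι : Type*} [Fintype V] (d : ℕ) (f : V → ι) (X Y : Finset V)
    (hXY : Disjoint X Y) (hX : X.card = d + 1) (hY : Y.card = d + 1) :
    ∃ (σ : V → V) (g : V → ι), Set.BijOn σ X Y ∧
      ((Finset.univ.image g).card + (d + 1) ≤ (Finset.univ.image f).card ∨
        (Finset.univ.image g).card ≤ (freeLabels f (X ∪ Y)).card + 1) ∧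
      ∀ G : SimpleGraph V, (∀ u v, f u = f v → G.Reachable u v) →
        (∀ x ∈ X, G.Reachable x (σ x)) → ∀ u v, g u = g v → G.Reachable u v := by
  induction d generalizing f X Y with
  | zero =>
    obtain ⟨a, rfl⟩ := Finset.card_eq_one.1 hX
    obtain ⟨b, rfl⟩ := Finset.card_eq_one.1 hY
    refine ⟨fun _ => b, mergeLabel f a b, by simp [Set.BijOn, Set.MapsTo, Set.SurjOn], ?_,
      fun G h1 h2 => reachable_of_mergeLabel_eq h1 (h2 a (by simp))⟩
    by_cases hab : f a = f b
    · right
      have : mergeLabel f a b = f := by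
        funext v
        unfold mergeLabel
        split_ifs with h
        · rw [h, hab]
        · rfl
      rw [this]
      exact card_image_le_card_freeLabels_add_one (l := f a) (by simp [hab])
    · left
      simpa using card_image_mergeLabel_lt hab
  | succ d ih =>
    have hXne : X.Nonempty := Finset.card_pos.1 (by omega)
    have hYne : Y.Nonempty := Finset.card_pos.1 (by omega)
    have hred : ∀ a ∈ X, ∀ b ∈ Y, ∃ (σ : V → V) (g : V → ι), Set.BijOn σ X Y ∧
        ((Finset.univ.image g).card + (d + 1) ≤ (Finset.univ.image (mergeLabel f a b)).card ∨
          (Finset.univ.image g).card ≤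
            (freeLabels (mergeLabel f a b) (X.erase a ∪ Y.erase b)).card + 1) ∧
        ∀ G : SimpleGraph V, (∀ u v, f u = f v → G.Reachable u v) →
          (∀ x ∈ X, G.Reachable x (σ x)) → ∀ u v, g u = g v → G.Reachable u v := by
      intro a ha b hb
      obtain ⟨σ, g, hσ, hcard, hG⟩ := ih (mergeLabel f a b) (X.erase a) (Y.erase b)
        (hXY.mono (Finset.erase_subset _ _) (Finset.erase_subset _ _))
        (by rw [Finset.card_erase_of_mem ha]; omega) (by rw [Finset.card_erase_of_mem hb]; omega)
      refine ⟨Function.update σ a b, g, bijOn_update ha hb hσ, hcard, fun G h1 h2 => ?_⟩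
      refine hG G (reachable_of_mergeLabel_eq h1 ?_) fun x hx => ?_
      · simpa using h2 a ha
      · have := h2 x (Finset.mem_of_mem_erase hx)
        rwa [Function.update_of_ne (Finset.ne_of_mem_erase hx)] at this
    rcases label_trichotomy f hXne hYne with ⟨l, hl⟩ | ⟨a, ha, b, hb, hab, z, hz, hzl⟩ | hinj
    · obtain ⟨a, ha⟩ := hXne
      obtain ⟨b, hb⟩ := hYne
      obtain ⟨σ, g, hσ, hcard, hG⟩ := hred a ha b hb
      refine ⟨σ, g, hσ, Or.inr ?_, hG⟩
      have hm : mergeLabel f a b = f := by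
        funext v
        unfold mergeLabel
        split_ifs with h
        · rw [h, hl a (Finset.mem_union_left _ ha), hl b (Finset.mem_union_right _ hb)]
        · rfl
      rw [hm] at hcard
      have h1 := card_image_le_card_freeLabels_add_one hl
      have h2 : (freeLabels f (X.erase a ∪ Y.erase b)).card + 1 ≤ (Finset.univ.image f).card := by
        have hz : ∃ z, z ∈ X.erase a := Finset.card_pos.1
          (by rw [Finset.card_erase_of_mem ha]; omega)
        obtain ⟨z, hz⟩ := hz
        refine Finset.card_lt_card ((Finset.ssubset_iff_of_subset Finset.sdiff_subset).2
          ⟨f z, Finset.mem_image_of_mem _ (Finset.mem_univ z), fun h => ?_⟩)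
        exact (Finset.mem_sdiff.1 h).2
          (Finset.mem_image_of_mem _ (Finset.mem_union_left _ hz))
      omega
    · obtain ⟨σ, g, hσ, hcard, hG⟩ := hred a ha b hb
      refine ⟨σ, g, hσ, ?_, hG⟩
      have h1 := card_image_mergeLabel_lt hab
      have h2 := Finset.card_le_card (freeLabels_mergeLabel_subset_of_mem hab hz hzl)
      omega
    · obtain ⟨a, ha⟩ := hXne
      obtain ⟨b, hb⟩ := hYne
      obtain ⟨σ, g, hσ, hcard, hG⟩ := hred a ha b hb
      have hab : f a ≠ f b := by
        intro h
        have := hinj (Finset.mem_union_left _ ha) (Finset.mem_union_right _ hb) h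
        exact Finset.disjoint_left.1 hXY ha (this ▸ hb)
      refine ⟨σ, g, hσ, Or.inl ?_, hG⟩
      have h1 := card_image_mergeLabel_lt hab
      have h2 := Finset.card_le_card (freeLabels_mergeLabel_subset (X := X) (Y := Y) hab)
      have h3 := Finset.card_insert_le (f a) (freeLabels f (X ∪ Y))
      have h4 : (freeLabels f (X ∪ Y)).card + (2 * d + 4) = (Finset.univ.image f).card := by
        have h5 : ((X ∪ Y).image f).card = 2 * d + 4 := by
          rw [Finset.card_image_of_injOn hinj, Finset.card_union_of_disjoint hXY]
          omega
        rw [← h5]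
        exact Finset.card_sdiff_add_card_eq_card
          (Finset.image_subset_image (Finset.subset_univ _))
      omega

theorem adj_mem_supp {V : Type*} {H : SimpleGraph V} {K : H.ConnectedComponent} {u v : V}
    (hu : u ∈ K.supp) (h : H.Adj u v) : v ∈ K.supp :=
  (SimpleGraph.ConnectedComponent.connectedComponentMk_eq_of_adj h).symm.trans hu

open Classical in
/-- A component all of whose vertices are covered by a matching has deficiency zero. -/
theorem compDeficiency_eq_zero_of_covered {V : Type*} [Fintype V] {H : SimpleGraph V} {A : Set V}
    (hbip : ∀ u v, H.Adj u v → (u ∈ A ↔ v ∉ A)) (K : H.ConnectedComponent) {T : Finset V}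
    {φ : V → V} (hadj : ∀ x ∈ T, H.Adj x (φ x)) (hinj : Set.InjOn φ T)
    (hTA : ∀ x ∈ T, x ∈ A) (hKA : ∀ v ∈ K.supp, v ∈ A → v ∈ T)
    (hKB : ∀ v ∈ K.supp, v ∉ A → ∃ x ∈ T, φ x = v) : compDeficiency H K = 0 := by
  have hmem : ∀ x : K.supp, (x : V) ∈ A → φ x ∈ K.supp := fun x hx =>
    adj_mem_supp x.2 (hadj x (hKA x x.2 hx))
  let φ' : K.supp → K.supp := fun x => if h : (x : V) ∈ A then ⟨φ x, hmem x h⟩ else x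
  have hφ' : ∀ x : K.supp, (x : V) ∈ A → ((φ' x : K.supp) : V) = φ x := fun x hx => by
    simp [φ', hx]
  let S : Finset K.supp := Finset.univ.filter fun x => (x : V) ∈ A
  have hS : ∀ x, x ∈ S ↔ (x : V) ∈ A := fun x => by simp [S]
  have h1 : S.card ≤ maxMatchingCard (H.induce K.supp) := by
    refine card_le_maxMatchingCard (φ := φ') (fun x hx => ?_) (fun x hx y hy hxy => ?_)
      (fun x hx hx' => ?_)
    · rw [hS] at hx
      rw [SimpleGraph.comap_adj]
      have := hadj x (hKA x x.2 hx)
      rwa [← hφ' x hx] at this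
    · rw [Finset.mem_coe, hS] at hx hy
      have h := congrArg Subtype.val hxy
      rw [hφ' x hx, hφ' y hy] at h
      exact Subtype.ext (hinj (hKA x x.2 hx) (hKA y y.2 hy) h)
    · rw [hS] at hx hx'
      rw [hφ' x hx] at hx'
      exact (hbip _ _ (hadj x (hKA x x.2 hx))).1 hx hx'
  have h2 : (Finset.univ.filter fun x : K.supp => (x : V) ∉ A).card ≤ S.card := by
    refine (Finset.card_le_card (t := S.image φ') fun y hy => ?_).trans Finset.card_image_le
    simp only [Finset.mem_filter, Finset.mem_univ, true_and] at hy
    obtain ⟨x, hx, hxy⟩ := hKB y y.2 hy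
    have hxK : x ∈ K.supp := adj_mem_supp y.2 (hxy ▸ (hadj x hx).symm)
    exact Finset.mem_image.2 ⟨⟨x, hxK⟩, (hS _).2 (hTA x hx),
      Subtype.ext ((hφ' ⟨x, hxK⟩ (hTA x hx)).trans hxy)⟩
  have h3 : K.supp.ncard = S.card + (Finset.univ.filter fun x : K.supp => (x : V) ∉ A).card := by
    rw [← Nat.card_coe_set_eq, Nat.card_eq_fintype_card, ← Finset.card_univ]
    exact (Finset.card_filter_add_card_filter_not _).symm
  unfold compDeficiency
  omega

open Classical in
/-- A component of deficiency zero is perfectly matched inside itself. -/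
theorem exists_matching_of_compDeficiency_eq_zero {V : Type*} [Fintype V] {H : SimpleGraph V}
    {A : Set V} (hbip : ∀ u v, H.Adj u v → (u ∈ A ↔ v ∉ A)) (K : H.ConnectedComponent)
    (hK : compDeficiency H K = 0) :
    ∃ π : V → V, (∀ x ∈ K.supp, x ∈ A → H.Adj x (π x)) ∧ Set.InjOn π (K.supp ∩ A) ∧
      ∀ y ∈ K.supp, y ∉ A → ∃ x ∈ K.supp, x ∈ A ∧ π x = y := by
  have hbip' : ∀ u v, (H.induce K.supp).Adj u v →
      (u ∈ (Subtype.val ⁻¹' A : Set K.supp) ↔ v ∉ (Subtype.val ⁻¹' A : Set K.supp)) :=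
    fun u v h => hbip u v h
  obtain ⟨T, φ, hTA, hadj, hinj, hcard⟩ := exists_injOn_card_eq_maxMatchingCard hbip'
  have hsupp : K.supp.ncard = (Finset.univ.filter fun x : K.supp => (x : V) ∈ A).card +
      (Finset.univ.filter fun x : K.supp => (x : V) ∉ A).card := by
    rw [← Nat.card_coe_set_eq, Nat.card_eq_fintype_card, ← Finset.card_univ]
    exact (Finset.card_filter_add_card_filter_not _).symm
  have hT : T ⊆ Finset.univ.filter fun x : K.supp => (x : V) ∈ A := fun x hx => by
    simpa using hTA x hx
  have hφT : T.image φ ⊆ Finset.univ.filter fun x : K.supp => (x : V) ∉ A := by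
    intro y hy
    obtain ⟨x, hx, rfl⟩ := Finset.mem_image.1 hy
    simpa using (hbip' _ _ (hadj x hx)).1 (hTA x hx)
  have hφcard : (T.image φ).card = T.card := Finset.card_image_of_injOn hinj
  have h1 := Finset.card_le_card hT
  have h2 := Finset.card_le_card hφT
  unfold compDeficiency at hK
  have hTeq := Finset.eq_of_subset_of_card_le hT (by omega)
  have hφTeq := Finset.eq_of_subset_of_card_le hφT (by omega)
  have hmem : ∀ x : K.supp, (x : V) ∈ A → x ∈ T := fun x hx => by
    rw [hTeq]
    simpa using hx
  let π : V → V := fun v => if h : v ∈ K.supp then (φ ⟨v, h⟩ : V) else v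
  have hπ : ∀ x : K.supp, π x = φ x := fun x => dif_pos x.2
  refine ⟨π, fun x hx hxA => ?_, fun x hx y hy hxy => ?_, fun y hy hyA => ?_⟩
  · have : H.Adj x (φ ⟨x, hx⟩) := hadj ⟨x, hx⟩ (hmem ⟨x, hx⟩ hxA)
    rwa [← hπ] at this
  · have h := (hπ ⟨x, hx.1⟩).symm.trans (hxy.trans (hπ ⟨y, hy.1⟩))
    exact congrArg Subtype.val
      (hinj (hmem ⟨x, hx.1⟩ hx.2) (hmem ⟨y, hy.1⟩ hy.2) (Subtype.ext h))
  · have : (⟨y, hy⟩ : K.supp) ∈ T.image φ := by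
      rw [hφTeq]
      simpa using hyA
    obtain ⟨x, hx, hxy⟩ := Finset.mem_image.1 this
    exact ⟨x, x.2, hTA x hx, (hπ x).trans (congrArg Subtype.val hxy)⟩

open Classical in
/-- An injection of `A` that leaves no edge from `A` out of a perfectly matched component also
covers that component by vertices inside it. -/
theorem exists_preimage_of_compDeficiency_eq_zero {V : Type*} [Fintype V] {H : SimpleGraph V}
    {A : Set V} (hbip : ∀ u v, H.Adj u v → (u ∈ A ↔ v ∉ A)) (K : H.ConnectedComponent)
    (hK : compDeficiency H K = 0) {ψ : V → V} (hψ : Set.InjOn ψ A)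
    (hadj : ∀ x ∈ K.supp, x ∈ A → H.Adj x (ψ x)) {y : V} (hy : y ∈ K.supp) (hyA : y ∉ A) :
    ∃ x ∈ K.supp, x ∈ A ∧ ψ x = y := by
  obtain ⟨π, -, -, hπ⟩ := exists_matching_of_compDeficiency_eq_zero hbip K hK
  set KA : Finset V := Finset.univ.filter fun v => v ∈ K.supp ∧ v ∈ A with hKA
  set KB : Finset V := Finset.univ.filter fun v => v ∈ K.supp ∧ v ∉ A with hKB
  have h1 : KA.image ψ ⊆ KB := by
    intro z hz
    obtain ⟨x, hx, rfl⟩ := Finset.mem_image.1 hz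
    simp only [hKA, Finset.mem_filter, Finset.mem_univ, true_and] at hx
    simp only [hKB, Finset.mem_filter, Finset.mem_univ, true_and]
    have h := hadj x hx.1 hx.2
    exact ⟨adj_mem_supp hx.1 h, (hbip _ _ h).1 hx.2⟩
  have h2 : KB ⊆ KA.image π := by
    intro z hz
    simp only [hKB, Finset.mem_filter, Finset.mem_univ, true_and] at hz
    obtain ⟨x, hx, hxA, rfl⟩ := hπ z hz.1 hz.2
    exact Finset.mem_image_of_mem _ (Finset.mem_filter.2 ⟨Finset.mem_univ x, hx, hxA⟩)
  have h3 : (KA.image ψ).card = KA.card := by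
    refine Finset.card_image_of_injOn (hψ.mono fun x hx => ?_)
    exact (Finset.mem_filter.1 hx).2.2
  have h4 := (Finset.card_le_card h2).trans Finset.card_image_le
  have h5 := Finset.eq_of_subset_of_card_le h1 (by omega)
  have h6 : y ∈ KA.image ψ := by
    rw [h5, hKB]
    simp only [Finset.mem_filter, Finset.mem_univ, true_and]
    exact ⟨hy, hyA⟩
  obtain ⟨x, hx, hxy⟩ := Finset.mem_image.1 h6
  have hx' := (Finset.mem_filter.1 hx).2
  exact ⟨x, hx'.1, hx'.2, hxy⟩

open Classical in
/-- The pairs of a perfect matching that are not edges of `H` outnumber the exposed vertices of a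
maximum matching of `H` by at least the number of perfectly matched components they meet. -/
theorem card_add_card_touched_le {V : Type*} [Fintype V] {H : SimpleGraph V} {A : Set V}
    (hbip : ∀ u v, H.Adj u v → (u ∈ A ↔ v ∉ A)) {ψ : V → V} (hψ : Set.InjOn ψ A)
    (D : Finset V) (hD : ∀ x, x ∈ D ↔ x ∈ A ∧ ¬ H.Adj x (ψ x)) :
    A.ncard + ((D.image H.connectedComponentMk).filter fun K => compDeficiency H K = 0).card ≤
      D.card + maxMatchingCard H := by
  set Z := (D.image H.connectedComponentMk).filter fun K => compDeficiency H K = 0 with hZ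
  have hZ0 : ∀ K ∈ Z, compDeficiency H K = 0 := fun K hK => (Finset.mem_filter.1 hK).2
  have hchoice : ∀ K : H.ConnectedComponent, ∃ π : V → V, K ∈ Z →
      (∀ x ∈ K.supp, x ∈ A → H.Adj x (π x)) ∧ Set.InjOn π (K.supp ∩ A) := by
    intro K
    by_cases hK : K ∈ Z
    · obtain ⟨π, h1, h2, -⟩ := exists_matching_of_compDeficiency_eq_zero hbip K (hZ0 K hK)
      exact ⟨π, fun _ => ⟨h1, h2⟩⟩
    · exact ⟨id, fun h => absurd h hK⟩
  choose π hπ using hchoice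
  set m := H.connectedComponentMk with hm
  let φ : V → V := fun v => if m v ∈ Z then π (m v) v else ψ v
  set T : Finset V := Finset.univ.filter fun v => v ∈ A ∧ (m v ∈ Z ∨ v ∉ D) with hT
  have hTmem : ∀ v, v ∈ T ↔ v ∈ A ∧ (m v ∈ Z ∨ v ∉ D) := fun v => by simp [hT]
  have hTadj : ∀ x ∈ T, H.Adj x (φ x) := by
    intro x hx
    obtain ⟨hxA, hx'⟩ := (hTmem x).1 hx
    by_cases h : m x ∈ Z
    · simp only [φ, h, if_true]
      exact (hπ _ h).1 x rfl hxA
    · simp only [φ, h, if_false]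
      have := hx'.resolve_left h
      rw [hD] at this
      tauto
  have hTm : ∀ x ∈ T, m (φ x) = m x := fun x hx =>
    (SimpleGraph.ConnectedComponent.connectedComponentMk_eq_of_adj (hTadj x hx)).symm
  have hTle : T.card ≤ maxMatchingCard H := by
    refine card_le_maxMatchingCard hTadj (fun x hx y hy hxy => ?_) (fun x hx hx' => ?_)
    · have hmxy : m x = m y := by rw [← hTm x hx, ← hTm y hy, hxy]
      have hxA := ((hTmem x).1 hx).1
      have hyA := ((hTmem y).1 hy).1
      by_cases h : m y ∈ Z
      · simp only [φ, hmxy, h, if_true] at hxy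
        exact (hπ _ h).2 ⟨hmxy, hxA⟩ ⟨rfl, hyA⟩ hxy
      · simp only [φ, hmxy, h, if_false] at hxy
        exact hψ hxA hyA hxy
    · exact (hbip _ _ (hTadj x hx)).1 ((hTmem x).1 hx).1 ((hTmem _).1 hx').1
  have hAcard : A.ncard = T.card + (D.filter fun v => m v ∉ Z).card := by
    rw [← Finset.card_union_of_disjoint]
    · rw [← Set.ncard_coe_finset]
      congr 1
      ext v
      simp only [Finset.coe_union, Set.mem_union, Finset.mem_coe, hTmem, Finset.mem_filter]
      have := hD v
      tauto
    · rw [Finset.disjoint_left]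
      intro v hv hv'
      rw [hTmem] at hv
      rw [Finset.mem_filter] at hv'
      tauto
  have hDcard : (D.filter fun v => m v ∈ Z).card + (D.filter fun v => m v ∉ Z).card = D.card :=
    Finset.card_filter_add_card_filter_not _
  have hZcard : Z.card ≤ (D.filter fun v => m v ∈ Z).card := by
    refine (Finset.card_le_card (t := (D.filter fun v => m v ∈ Z).image m) fun K hK => ?_).trans
      Finset.card_image_le
    obtain ⟨x, hx, rfl⟩ := Finset.mem_image.1 (Finset.mem_filter.1 hK).1
    exact Finset.mem_image_of_mem _ (Finset.mem_filter.2 ⟨hx, hK⟩)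
  omega

open Classical in
/-- If `H` has no perfect matching, then making it connected and perfectly matchable takes at least
one edge per exposed pair of a maximum matching and one per perfectly matched component. -/
theorem card_add_cZero_le {V : Type*} [Fintype V] {H : SimpleGraph V} {A : Set V}
    (hbip : ∀ u v, H.Adj u v → (u ∈ A ↔ v ∉ A)) {F : Finset (Sym2 V)}
    (hFbip : ∀ u v, s(u, v) ∈ F → (u ∈ A ↔ v ∉ A))
    (hconn : (H ⊔ SimpleGraph.fromEdgeSet (↑F : Set (Sym2 V))).Connected)
    (hperf : HasPerfectMatching (H ⊔ SimpleGraph.fromEdgeSet (↑F : Set (Sym2 V))))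
    (hlt : maxMatchingCard H < A.ncard) :
    A.ncard + cZero H ≤ F.card + maxMatchingCard H := by
  obtain ⟨ψ, hψadj, hψ⟩ := exists_injOn_of_hasPerfectMatching A hperf
  set D : Finset V := Finset.univ.filter fun x => x ∈ A ∧ ¬ H.Adj x (ψ x) with hDdef
  have hD : ∀ x, x ∈ D ↔ x ∈ A ∧ ¬ H.Adj x (ψ x) := fun x => by simp [hDdef]
  have hDF : ∀ x ∈ D, s(x, ψ x) ∈ F := by
    intro x hx
    rw [hD] at hx
    have := hψadj x hx.1
    rw [SimpleGraph.sup_adj, SimpleGraph.fromEdgeSet_adj] at this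
    exact (this.resolve_left hx.2).1
  have hψA : ∀ x ∈ D, ψ x ∉ A := fun x hx => (hFbip _ _ (hDF x hx)).1 ((hD x).1 hx).1
  have htouch := card_add_card_touched_le hbip hψ D hD
  set Z := (D.image H.connectedComponentMk).filter fun K => compDeficiency H K = 0 with hZ
  set U : Finset H.ConnectedComponent := Finset.univ.filter fun K =>
    compDeficiency H K = 0 ∧ K ∉ D.image H.connectedComponentMk with hU
  have hUmem : ∀ K, K ∈ U ↔ compDeficiency H K = 0 ∧ K ∉ D.image H.connectedComponentMk :=
    fun K => by simp [hU]
  have hZU : cZero H = Z.card + U.card := by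
    rw [← Finset.card_union_of_disjoint]
    · unfold cZero
      rw [Nat.card_eq_fintype_card, Fintype.card_subtype]
      congr 1
      ext K
      simp only [Finset.mem_union, hUmem, hZ, Finset.mem_filter, Finset.mem_univ, true_and]
      tauto
    · rw [Finset.disjoint_left]
      intro K hK hK'
      rw [hUmem] at hK'
      rw [hZ, Finset.mem_filter] at hK
      tauto
  set P := D.image fun x => s(x, ψ x) with hP
  have hPF : P ⊆ F := by
    intro e he
    obtain ⟨x, hx, rfl⟩ := Finset.mem_image.1 he
    exact hDF x hx
  have hPcard : P.card = D.card := by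
    refine Finset.card_image_of_injOn fun x hx y hy hxy => ?_
    rcases Sym2.eq_iff.1 hxy with h | h
    · exact h.1
    · exact absurd ((hD y).1 hy).1 (h.2 ▸ hψA x hx)
  have hFcard := Finset.card_sdiff_add_card_eq_card hPF
  let m : V → H.ConnectedComponent := H.connectedComponentMk
  let g : V → Option U := fun v => if h : m v ∈ U then some ⟨m v, h⟩ else none
  have hgD : ∀ x ∈ D, m x ∉ U := fun x hx h =>
    ((hUmem _).1 h).2 (Finset.mem_image_of_mem _ hx)
  have hgψ : ∀ x ∈ D, m (ψ x) ∉ U := by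
    intro x hx h
    obtain ⟨y, hy, hyA, hxy⟩ := exists_preimage_of_compDeficiency_eq_zero hbip (m (ψ x))
      ((hUmem _).1 h).1 hψ (fun z hz hzA => by
        by_contra hne
        refine ((hUmem _).1 h).2 (Finset.mem_image.2 ⟨z, (hD z).2 ⟨hzA, hne⟩, hz⟩))
      rfl (hψA x hx)
    have hyx : y = x := hψ hyA ((hD x).1 hx).1 hxy
    have hmx : m x = m (ψ x) := hyx ▸ hy
    exact hgD x hx (hmx ▸ h)
  have hsurj : Function.Surjective g := by
    rintro (_ | ⟨K, hK⟩)
    · have : 0 < D.card := by omega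
      obtain ⟨x, hx⟩ := Finset.card_pos.1 this
      exact ⟨x, by simp [g, hgD x hx]⟩
    · obtain ⟨v, rfl⟩ := K.exists_rep
      exact ⟨v, dif_pos hK⟩
  have hcount := card_le_card_add_one_of_connected hconn g hsurj (F \ P) (by
    intro u v huv hne
    rw [SimpleGraph.sup_adj, SimpleGraph.fromEdgeSet_adj] at huv
    rcases huv with huv | huv
    · have : m u = m v := SimpleGraph.ConnectedComponent.connectedComponentMk_eq_of_adj huv
      exact absurd (by simp only [g, this]) hne
    · refine Finset.mem_sdiff.2 ⟨huv.1, fun h => hne ?_⟩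
      obtain ⟨x, hx, hxuv⟩ := Finset.mem_image.1 h
      have h1 : g x = none := dif_neg (hgD x hx)
      have h2 : g (ψ x) = none := dif_neg (hgψ x hx)
      rcases Sym2.eq_iff.1 hxuv with ⟨rfl, rfl⟩ | ⟨rfl, rfl⟩
      · rw [h1, h2]
      · rw [h1, h2])
  rw [Nat.card_eq_fintype_card, Fintype.card_option, Fintype.card_coe] at hcount
  omega

open Classical in
/-- A balanced bipartite graph has a set of new pairs between the two sides that makes it connected
and perfectly matchable and attains one of the two lower bounds. -/
theorem exists_augmenting_pairs {V : Type*} [Fintype V] {H : SimpleGraph V} {A : Set V}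
    (hbip : ∀ u v, H.Adj u v → (u ∈ A ↔ v ∉ A)) (hA : A.Nonempty)
    (hcard : A.ncard = Aᶜ.ncard) :
    ∃ F : Finset (Sym2 V), (∀ e ∈ F, ∃ a ∈ A, ∃ b ∈ Aᶜ, e = s(a, b)) ∧
      (∀ e ∈ F, e ∉ H.edgeSet) ∧
      (H ⊔ SimpleGraph.fromEdgeSet (↑F : Set (Sym2 V))).Connected ∧
      HasPerfectMatching (H ⊔ SimpleGraph.fromEdgeSet (↑F : Set (Sym2 V))) ∧
      (F.card + 1 ≤ numComponents H ∨
        maxMatchingCard H < A.ncard ∧ F.card + maxMatchingCard H ≤ A.ncard + cZero H) := by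
  obtain ⟨T, φ, hTA, hφadj, hφinj, hT⟩ := exists_injOn_card_eq_maxMatchingCard hbip
  have hφA : ∀ x ∈ T, φ x ∈ Aᶜ := fun x hx => (hbip _ _ (hφadj x hx)).1 (hTA x hx)
  set X : Finset V := A.toFinset \ T with hX
  set Y : Finset V := Aᶜ.toFinset \ T.image φ with hY
  have hXmem : ∀ x, x ∈ X ↔ x ∈ A ∧ x ∉ T := fun x => by simp [hX]
  have hYmem : ∀ y, y ∈ Y ↔ y ∈ Aᶜ ∧ y ∉ T.image φ := fun y => by
    rw [hY, Finset.mem_sdiff, Set.mem_toFinset]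
  have hXcard : X.card + T.card = A.ncard := by
    rw [Set.ncard_eq_toFinset_card']
    exact Finset.card_sdiff_add_card_eq_card fun x hx => by simpa using hTA x hx
  have hYcard : Y.card + T.card = A.ncard := by
    rw [hcard, Set.ncard_eq_toFinset_card', ← Finset.card_image_of_injOn hφinj]
    refine Finset.card_sdiff_add_card_eq_card fun y hy => ?_
    obtain ⟨x, hx, rfl⟩ := Finset.mem_image.1 hy
    rw [Set.mem_toFinset]
    exact hφA x hx
  have hXY : Disjoint X Y := Finset.disjoint_left.2 fun x hx hx' =>
    ((hYmem x).1 hx').1 ((hXmem x).1 hx).1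
  set m : V → H.ConnectedComponent := H.connectedComponentMk with hm
  have hmcard : (Finset.univ.image m).card = numComponents H := by
    unfold numComponents
    rw [Nat.card_eq_fintype_card, ← Finset.card_univ]
    congr 1
    exact Finset.image_univ_of_surjective Quot.mk_surjective
  have hfree : (freeLabels m (X ∪ Y)).card ≤ cZero H := by
    unfold cZero
    rw [Nat.card_eq_fintype_card, Fintype.card_subtype]
    refine Finset.card_le_card fun K hK => ?_
    rw [Finset.mem_filter]
    have hK' : ∀ v ∈ K.supp, v ∉ X ∪ Y := fun v hv hv' =>
      (Finset.mem_sdiff.1 hK).2 (Finset.mem_image.2 ⟨v, hv', hv⟩)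
    refine ⟨Finset.mem_univ K, compDeficiency_eq_zero_of_covered hbip K hφadj hφinj hTA ?_ ?_⟩
    · intro v hv hvA
      by_contra hvT
      exact hK' v hv (Finset.mem_union_left _ ((hXmem v).2 ⟨hvA, hvT⟩))
    · intro v hv hvA
      by_contra hvT
      refine hK' v hv (Finset.mem_union_right _ ((hYmem v).2 ⟨hvA, fun h => hvT ?_⟩))
      simpa using h
  have hBne : (Aᶜ : Set V).Nonempty := by
    rw [← Set.ncard_pos, ← hcard]
    exact (Set.ncard_pos).2 hA
  obtain ⟨σ, g, hσ, hg, hgreach⟩ : ∃ (σ : V → V) (g : V → H.ConnectedComponent),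
      Set.BijOn σ X Y ∧
      ((Finset.univ.image g).card + X.card ≤ numComponents H ∨
        0 < X.card ∧ (Finset.univ.image g).card ≤ cZero H + 1) ∧
      ∀ G : SimpleGraph V, (∀ u v, m u = m v → G.Reachable u v) →
        (∀ x ∈ X, G.Reachable x (σ x)) → ∀ u v, g u = g v → G.Reachable u v := by
    rcases Nat.eq_zero_or_pos X.card with h0 | hpos
    · have hX0 : X = ∅ := Finset.card_eq_zero.1 h0
      have hY0 : Y = ∅ := Finset.card_eq_zero.1 (by omega)
      refine ⟨id, m, by simp [hX0, hY0], Or.inl (by omega), fun G hG _ => hG⟩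
    · obtain ⟨σ, g, hσ, hg, hreach⟩ := exists_merging_bijOn (X.card - 1) m X Y hXY
        (by omega) (by omega)
      exact ⟨σ, g, hσ, by omega, hreach⟩
  obtain ⟨L, hLpairs, hLcard, hL⟩ := exists_linking_pairs hA hBne
    (Set.union_compl_self A) _ g le_rfl
  set E : Finset (Sym2 V) := X.image fun x => s(x, σ x) with hE
  set F : Finset (Sym2 V) := (E ∪ L).filter fun e => e ∉ H.edgeSet with hF
  have hpairs : ∀ e ∈ E ∪ L, ∃ a ∈ A, ∃ b ∈ Aᶜ, e = s(a, b) := by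
    intro e he
    rcases Finset.mem_union.1 he with he | he
    · obtain ⟨x, hx, rfl⟩ := Finset.mem_image.1 he
      exact ⟨x, ((hXmem x).1 hx).1, σ x, ((hYmem _).1 (hσ.mapsTo hx)).1, rfl⟩
    · exact hLpairs e he
  set G : SimpleGraph V := H ⊔ SimpleGraph.fromEdgeSet (↑F : Set (Sym2 V)) with hG
  have hadj : ∀ a b, s(a, b) ∈ E ∪ L → G.Adj a b := by
    intro a b hab
    rw [hG, SimpleGraph.sup_adj, SimpleGraph.fromEdgeSet_adj]
    by_cases h : H.Adj a b
    · exact Or.inl h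
    · refine Or.inr ⟨Finset.mem_filter.2 ⟨hab, h⟩, ?_⟩
      rintro rfl
      obtain ⟨x, hx, y, hy, hxy⟩ := hpairs _ hab
      rcases Sym2.eq_iff.1 hxy with ⟨rfl, rfl⟩ | ⟨rfl, rfl⟩ <;> exact hy hx
  have hσadj : ∀ x ∈ X, G.Adj x (σ x) := fun x hx =>
    hadj _ _ (Finset.mem_union_left _ (Finset.mem_image_of_mem _ hx))
  refine ⟨F, fun e he => hpairs e (Finset.mem_filter.1 he).1,
    fun e he => (Finset.mem_filter.1 he).2, ?_, ?_, ?_⟩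
  · have : Nonempty V := hA.to_type
    refine ⟨hL G (hgreach G (fun u v h => ?_) fun x hx => (hσadj x hx).reachable)
      fun a b hab => (hadj a b (Finset.mem_union_right _ hab)).reachable⟩
    exact (SimpleGraph.ConnectedComponent.exact h).mono le_sup_left
  · let ψ : V → V := fun v => if v ∈ T then φ v else σ v
    have hψT : ∀ x ∈ T, ψ x = φ x := fun x hx => if_pos hx
    have hψX : ∀ x ∈ X, ψ x = σ x := fun x hx => if_neg ((hXmem x).1 hx).2
    have hAsplit : ∀ x ∈ A, x ∈ T ∨ x ∈ X := fun x hx => by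
      rw [hXmem]
      tauto
    refine hasPerfectMatching_of_bijOn (A := A) (ψ := ψ) ⟨?_, ?_, ?_⟩ fun x hx => ?_
    · intro x hx
      rcases hAsplit x hx with h | h
      · rw [hψT x h]
        exact hφA x h
      · rw [hψX x h]
        exact ((hYmem _).1 (hσ.mapsTo h)).1
    · have hTX : ∀ x ∈ T, ∀ y ∈ X, φ x ≠ σ y := fun x hx y hy h =>
        ((hYmem _).1 (hσ.mapsTo hy)).2 (Finset.mem_image.2 ⟨x, hx, h⟩)
      intro x hx y hy hxy
      rcases hAsplit x hx with h | h <;> rcases hAsplit y hy with h' | h'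
      · rw [hψT x h, hψT y h'] at hxy
        exact hφinj h h' hxy
      · rw [hψT x h, hψX y h'] at hxy
        exact absurd hxy (hTX x h y h')
      · rw [hψX x h, hψT y h'] at hxy
        exact absurd hxy.symm (hTX y h' x h)
      · rw [hψX x h, hψX y h'] at hxy
        exact hσ.injOn h h' hxy
    · intro y hy
      by_cases h : y ∈ T.image φ
      · obtain ⟨x, hx, rfl⟩ := Finset.mem_image.1 h
        exact ⟨x, hTA x hx, hψT x hx⟩
      · obtain ⟨x, hx, rfl⟩ := hσ.surjOn ((hYmem y).2 ⟨hy, h⟩)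
        exact ⟨x, ((hXmem x).1 hx).1, hψX x hx⟩
    · rcases hAsplit x hx with h | h
      · rw [hψT x h]
        exact Or.inl (hφadj x h)
      · rw [hψX x h]
        exact hσadj x h
  · have h1 : F.card ≤ (E ∪ L).card := Finset.card_filter_le _ _
    have h2 := Finset.card_union_le E L
    have h3 : E.card ≤ X.card := Finset.card_image_le
    omega

/-- Remark 1. Let `H` be a balanced bipartite simple graph with
bipartition `(A, B)`, `|A| = |B| = n ≥ 1`, where only pairs between `A` and `B` may be
added.  Then `opt'(H) = c(H) - 1` if `def(H) = 0` or `(1/2)·def(H) < c₊(H)`, and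
`opt'(H) = (1/2)·def(H) + c₀(H)` if `def(H) > 0` and `(1/2)·def(H) ≥ c₊(H)`. -/
theorem augPMST_bipartite {V : Type*} [Fintype V] (H : SimpleGraph V)
    (A B : Set V) (hdisj : Disjoint A B) (hcover : A ∪ B = Set.univ)
    (n : ℕ) (hn : 1 ≤ n) (hA : A.ncard = n) (hB : B.ncard = n)
    (hbip : ∀ u v : V, H.Adj u v → (u ∈ A ∧ v ∈ B) ∨ (u ∈ B ∧ v ∈ A)) :
    ((deficiency H = 0 ∨ deficiency H < 2 * cPlus H) →
        IsLeast (optSetBip H A B) (numComponents H - 1)) ∧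
      ((0 < deficiency H ∧ 2 * cPlus H ≤ deficiency H) →
        IsLeast (optSetBip H A B) (deficiency H / 2 + cZero H)) := by
  classical
  have hBA : B = Aᶜ := (IsCompl.compl_eq ⟨hdisj, codisjoint_iff.2 hcover⟩).symm
  subst hBA
  have hbip' : ∀ u v, H.Adj u v → (u ∈ A ↔ v ∉ A) := by
    intro u v h
    have := hbip u v h
    simp only [Set.mem_compl_iff] at this
    tauto
  have hAne : A.Nonempty := (Set.ncard_pos).1 (by omega)
  obtain ⟨F, hFpairs, hFnot, hFconn, hFperf, hFcard⟩ :=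
    exists_augmenting_pairs hbip' hAne (hA.trans hB.symm)
  have hmem : F.card ∈ optSetBip H A Aᶜ := ⟨F, hFpairs, hFnot, hFconn, hFperf, rfl⟩
  have hV : Fintype.card V = 2 * n := by
    rw [← Nat.card_eq_fintype_card, ← Set.ncard_add_ncard_compl A]
    omega
  have hν : maxMatchingCard H ≤ n := by
    obtain ⟨T, φ, hTA, -, -, hT⟩ := exists_injOn_card_eq_maxMatchingCard hbip'
    rw [← hT, ← hA, ← Set.ncard_coe_finset]
    exact Set.ncard_le_ncard hTA
  have hdef : deficiency H = 2 * (n - maxMatchingCard H) := by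
    unfold deficiency
    omega
  have hcomp : numComponents H = cPlus H + cZero H := by
    unfold numComponents cPlus cZero
    rw [Nat.card_eq_fintype_card, Nat.card_eq_fintype_card, Nat.card_eq_fintype_card,
      Fintype.card_subtype, Fintype.card_subtype, ← Finset.card_univ,
      ← Finset.card_filter_add_card_filter_not (s := Finset.univ)
        fun K : H.ConnectedComponent => 0 < compDeficiency H K]
    simp only [Nat.pos_iff_ne_zero, not_not]
  have hlow : ∀ k ∈ optSetBip H A Aᶜ, numComponents H ≤ k + 1 := by
    rintro k ⟨S, -, -, hconn, -, rfl⟩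
    refine card_le_card_add_one_of_connected hconn H.connectedComponentMk Quot.mk_surjective S ?_
    intro u v huv hne
    rw [SimpleGraph.sup_adj, SimpleGraph.fromEdgeSet_adj] at huv
    exact (huv.resolve_left fun h =>
      hne (SimpleGraph.ConnectedComponent.connectedComponentMk_eq_of_adj h)).1
  have hlow' : maxMatchingCard H < n →
      ∀ k ∈ optSetBip H A Aᶜ, n + cZero H ≤ k + maxMatchingCard H := by
    rintro hlt k ⟨S, hpairs, -, hconn, hperf, rfl⟩
    rw [← hA] at hlt ⊢
    refine card_add_cZero_le hbip' (fun u v huv => ?_) hconn hperf hlt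
    obtain ⟨a, ha, b, hb, hab⟩ := hpairs _ huv
    rw [Set.mem_compl_iff] at hb
    rcases Sym2.eq_iff.1 hab with ⟨rfl, rfl⟩ | ⟨rfl, rfl⟩ <;> tauto
  have hFlow := hlow _ hmem
  have hFlow' := fun h => hlow' h _ hmem
  constructor
  · intro h
    have hF : F.card = numComponents H - 1 := by omega
    refine ⟨hF ▸ hmem, fun k hk => ?_⟩
    have := hlow k hk
    omega
  · rintro ⟨h1, h2⟩
    have hlt : maxMatchingCard H < n := by omega
    have hF : F.card = deficiency H / 2 + cZero H := by
      have := hFlow' hlt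
      omega
    refine ⟨hF ▸ hmem, fun k hk => ?_⟩
    have := hlow' hlt k hk
    omega
end
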